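/- arXiv:2509.07086 — 3 statements merged into one kernel-verified Lean document; each statement's English description precedes it below -/
import Mathlib

section
/- Let m, n, k be natural numbers with m, n ≥ 1, let ρ be a positive semidefinite matrix indexed by Fin m × Fin n over ℂ, and let φ ∈ ℂ^m be a unit vector. Set A = 1_m − φφ* (the orthogonal projection onto the complement of φ) and σ = (A ⊗ 1_n) ρ (A ⊗ 1_n), where A ⊗ 1_n is the Kronecker product acting on ℂ^(Fin m × Fin n). If SN(σ) ≤ k, then SN(ρ) ≤ k + 1; that is, the Schmidt number drops by at most one under the local projection A ⊗ 1_n. -/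
open Matrix Kronecker ComplexOrder

/-- The Schmidt rank of a vector `ψ ∈ ℂ^(Fin m × Fin n)`: the rank of the associated
`m × n` matrix with `(i,j)` entry `ψ (i,j)`. -/
noncomputable def schmidtRank {m n : ℕ} (ψ : Fin m × Fin n → ℂ) : ℕ :=
  (Matrix.of fun i j => ψ (i, j) : Matrix (Fin m) (Fin n) ℂ).rank

/-- Rank-one outer product `v v*`. -/
def outer {d : Type*} (v : d → ℂ) : Matrix d d ℂ :=
  Matrix.of fun a b => v a * star (v b)

/-- `SNle ρ k` : the Schmidt number of `ρ` is at most `k`, i.e. `ρ` is a finite sum of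
outer products of vectors of Schmidt rank at most `k`. -/
def SNle {m n : ℕ} (ρ : Matrix (Fin m × Fin n) (Fin m × Fin n) ℂ) (k : ℕ) : Prop :=
  ∃ (T : ℕ) (v : Fin T → (Fin m × Fin n → ℂ)),
    (∀ t, schmidtRank (v t) ≤ k) ∧ ρ = ∑ t, outer (v t)

/-- Partial transpose on the second (B) subsystem. -/
def ptB {m n : ℕ} (ρ : Matrix (Fin m × Fin n) (Fin m × Fin n) ℂ) :
    Matrix (Fin m × Fin n) (Fin m × Fin n) ℂ :=
  Matrix.of fun p q => ρ (p.1, q.2) (q.1, p.2)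

/-- Partial transpose on the first (A) subsystem. -/
def ptA {m n : ℕ} (ρ : Matrix (Fin m × Fin n) (Fin m × Fin n) ℂ) :
    Matrix (Fin m × Fin n) (Fin m × Fin n) ℂ :=
  Matrix.of fun p q => ρ (q.1, p.2) (p.1, q.2)


theorem aux_pinv {d : Type*} [Fintype d] [DecidableEq d] (S : Matrix d d ℂ) (hS : S.IsHermitian) :
    ∃ G : Matrix d d ℂ, Gᴴ = G ∧ G * S * G = G ∧ S * G * S = S := by
  let f := Unitary.conjStarAlgAut ℂ (Matrix d d ℂ) hS.eigenvectorUnitary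
  let D : Matrix d d ℂ := diagonal (RCLike.ofReal ∘ hS.eigenvalues)
  let E : Matrix d d ℂ := diagonal (fun i => (RCLike.ofReal (hS.eigenvalues i) : ℂ)⁻¹)
  have h : S = f D := hS.spectral_theorem
  refine ⟨f E, ?_, ?_, ?_⟩
  · rw [← star_eq_conjTranspose, ← map_star]
    congr 1
    rw [star_eq_conjTranspose, diagonal_conjTranspose]
    congr 1
    ext i
    simp
  · rw [h, ← map_mul, ← map_mul]
    congr 1
    simp only [D, E, diagonal_mul_diagonal]
    congr 1
    ext i
    by_cases h0 : hS.eigenvalues i = 0 <;> simp [h0]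
  · rw [h, ← map_mul, ← map_mul]
    congr 1
    simp only [D, E, diagonal_mul_diagonal]
    congr 1
    ext i
    by_cases h0 : hS.eigenvalues i = 0 <;> simp [h0]

theorem aux_sqrt {d : Type*} [Fintype d] [DecidableEq d] (S : Matrix d d ℂ) (hS : S.PosSemidef) :
    ∃ R : Matrix d d ℂ, S = R * Rᴴ := by
  let f := Unitary.conjStarAlgAut ℂ (Matrix d d ℂ) hS.1.eigenvectorUnitary
  let D : Matrix d d ℂ := diagonal (RCLike.ofReal ∘ hS.1.eigenvalues)
  let E : Matrix d d ℂ := diagonal (fun i => ((Real.sqrt (hS.1.eigenvalues i) : ℝ) : ℂ))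
  have h : S = f D := hS.1.spectral_theorem
  refine ⟨f E, ?_⟩
  rw [← star_eq_conjTranspose, ← map_star, ← map_mul, h]
  congr 1
  rw [star_eq_conjTranspose, diagonal_conjTranspose, diagonal_mul_diagonal]
  simp only [D]
  congr 1
  ext i
  have := Real.mul_self_sqrt (hS.eigenvalues_nonneg i)
  simp only [Function.comp, Pi.star_apply, RCLike.star_def, Complex.conj_ofReal]
  rw [← Complex.ofReal_mul, this]
  rfl

theorem aux_outer {d ι : Type*} [Fintype ι] (M : Matrix d ι ℂ) :
    M * Mᴴ = ∑ t, outer (fun a => M a t) := by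
  ext a b
  simp [Matrix.mul_apply, Matrix.sum_apply, outer]

theorem aux_SNle {m n k : ℕ} {ι : Type*} [Fintype ι] (M : Matrix (Fin m × Fin n) ι ℂ)
    (h : ∀ t, schmidtRank (fun a => M a t) ≤ k) : SNle (M * Mᴴ) k := by
  refine ⟨Fintype.card ι, fun t a => M a ((Fintype.equivFin ι).symm t), fun t => h _, ?_⟩
  rw [aux_outer]
  exact ((Fintype.equivFin ι).symm.sum_comp (fun t => outer (fun a => M a t))).symm

theorem aux_rank {m n : ℕ} (M N : Matrix (Fin m) (Fin n) ℂ) :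
    (M + N).rank ≤ M.rank + N.rank := by
  unfold Matrix.rank
  rw [Matrix.mulVecLin_add]
  refine le_trans (Submodule.finrank_mono (t := M.mulVecLin.range ⊔ N.mulVecLin.range) ?_)
    (Submodule.finrank_add_le_finrank_add_finrank _ _)
  rintro _ ⟨x, rfl⟩
  exact Submodule.add_mem_sup ⟨x, rfl⟩ ⟨x, rfl⟩

theorem aux_drop {m n k : ℕ} (φ : Fin m → ℂ) (A : Matrix (Fin m) (Fin m) ℂ)
    (hA : A = 1 - Matrix.of fun i j => φ i * star (φ j)) (w : Fin m × Fin n → ℂ)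
    (h : schmidtRank ((A ⊗ₖ (1 : Matrix (Fin n) (Fin n) ℂ)) *ᵥ w) ≤ k) :
    schmidtRank w ≤ k + 1 := by
  unfold schmidtRank at *
  set W : Matrix (Fin m) (Fin n) ℂ := Matrix.of fun i j => w (i, j) with hW
  have h1 : (Matrix.of fun i j => ((A ⊗ₖ (1 : Matrix (Fin n) (Fin n) ℂ)) *ᵥ w) (i, j)) = A * W := by
    ext i j
    simp [Matrix.mulVec, dotProduct, Fintype.sum_prod_type, Matrix.mul_apply, hW,
      Matrix.one_apply]
  rw [h1] at h
  have h2 : W = A * W + vecMulVec φ (star φ ᵥ* W) := by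
    have : vecMulVec φ (star φ ᵥ* W) = (Matrix.of fun i j => φ i * star (φ j)) * W := by
      ext i j
      simp [vecMulVec_apply, vecMul, dotProduct, Matrix.mul_apply, Finset.mul_sum, mul_assoc]
    rw [this, hA, Matrix.sub_mul]
    simp
  rw [h2]
  exact (aux_rank _ _).trans (add_le_add h (rank_vecMulVec_le _ _))

/-- Under the local projection `A ⊗ 1` with `A = 1 - φφ*` (φ a unit vector), the Schmidt
number drops by at most one. -/
theorem schmidt_number_drop_at_most_one {m n k : ℕ} (hm : 1 ≤ m) (hn : 1 ≤ n)
    (ρ : Matrix (Fin m × Fin n) (Fin m × Fin n) ℂ) (hρ : ρ.PosSemidef)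
    (φ : Fin m → ℂ) (hφ : star φ ⬝ᵥ φ = 1)
    (A : Matrix (Fin m) (Fin m) ℂ)
    (hA : A = 1 - Matrix.of fun i j => φ i * star (φ j))
    (σ : Matrix (Fin m × Fin n) (Fin m × Fin n) ℂ)
    (hσ : σ = (A ⊗ₖ (1 : Matrix (Fin n) (Fin n) ℂ)) * ρ *
      (A ⊗ₖ (1 : Matrix (Fin n) (Fin n) ℂ)))
    (hSN : SNle σ k) : SNle ρ (k + 1) := by
  set P := A ⊗ₖ (1 : Matrix (Fin n) (Fin n) ℂ) with hP
  have hAH : Aᴴ = A := by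
    rw [hA]
    ext i j
    simp [Matrix.one_apply, mul_comm, eq_comm]
  have hPH : Pᴴ = P := by
    rw [hP, conjTranspose_kronecker, hAH, conjTranspose_one]
  have hρH : ρᴴ = ρ := hρ.1
  have hσH : σᴴ = σ := by
    rw [hσ]; simp only [conjTranspose_mul, hPH, hρH, Matrix.mul_assoc]
  obtain ⟨G, hG, hGS, hSG⟩ := aux_pinv σ hσH
  obtain ⟨R, hR⟩ := aux_sqrt ρ hρ
  obtain ⟨T, v, hv, hsum⟩ := hSN
  let V : Matrix (Fin m × Fin n) (Fin T) ℂ := Matrix.of fun a t => v t a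
  have hV : V * Vᴴ = σ := by rw [hsum, aux_outer]; rfl
  have hVV : σ * G * V = V := by
    have h0 : (1 - σ * G) * V = 0 := by
      rw [← self_mul_conjTranspose_eq_zero, conjTranspose_mul, Matrix.mul_assoc,
        ← Matrix.mul_assoc V, hV, ← Matrix.mul_assoc, Matrix.sub_mul, hSG]
      simp
    rw [Matrix.sub_mul, Matrix.one_mul, sub_eq_zero] at h0
    exact h0.symm
  let Y := ρ * P * G * V
  let X := R - ρ * P * G * P * R
  have hY : P * Y = V := by
    have : P * Y = (P * ρ * P) * G * V := by simp only [Y, Matrix.mul_assoc]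
    rw [this, ← hσ, hVV]
  have hYY : Y * Yᴴ = ρ * P * G * P * ρ := by
    have : Y * Yᴴ = ρ * P * (G * (V * Vᴴ) * G) * P * ρ := by
      simp only [Y, conjTranspose_mul, hG, hPH, hρH, Matrix.mul_assoc]
    rw [this, hV, hGS]
  have hXX : X * Xᴴ = ρ - ρ * P * G * P * ρ := by
    have : X * Xᴴ = R * Rᴴ - ρ * P * G * P * (R * Rᴴ) - (R * Rᴴ) * P * G * P * ρ
        + ρ * P * (G * (P * (R * Rᴴ) * P) * G) * P * ρ := by
      simp only [X, conjTranspose_sub, conjTranspose_mul, hG, hPH, hρH, Matrix.mul_assoc,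
        Matrix.sub_mul, Matrix.mul_sub]
      abel
    rw [this, ← hR, ← hσ, hGS]
    simp only [Matrix.mul_assoc]
    abel
  have hX : P * X = 0 := by
    rw [← self_mul_conjTranspose_eq_zero]
    have : P * X * (P * X)ᴴ = P * (X * Xᴴ) * P := by
      simp only [conjTranspose_mul, hPH, Matrix.mul_assoc]
    rw [this, hXX]
    have : P * (ρ - ρ * P * G * P * ρ) * P = P * ρ * P - (P * ρ * P) * G * (P * ρ * P) := by
      simp only [Matrix.mul_sub, Matrix.sub_mul, Matrix.mul_assoc]
    rw [this, ← hσ, hSG, sub_self]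
  have hfin : ρ = fromCols Y X * (fromCols Y X)ᴴ := by
    rw [conjTranspose_fromCols_eq_fromRows_conjTranspose, fromCols_mul_fromRows, hYY, hXX]
    abel
  rw [hfin]
  apply aux_SNle
  rintro (t | t)
  · apply aux_drop φ A hA
    have : (P *ᵥ fun a => fromCols Y X a (Sum.inl t)) = v t := by
      ext a
      exact congrFun (congrFun hY a) t
    rw [← hP, this]
    exact hv t
  · apply aux_drop φ A hA
    have : (P *ᵥ fun a => fromCols Y X a (Sum.inr t)) = 0 := by
      ext a
      exact congrFun (congrFun hX a) t
    rw [← hP, this]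
    have h0 : schmidtRank (0 : Fin m × Fin n → ℂ) = 0 := by
      unfold schmidtRank
      exact Matrix.rank_zero
    omega
end

section
/- Let m, n, k be natural numbers with m, n ≥ 1 and let ρ be a positive semidefinite matrix indexed by Fin (m+1) × Fin n over ℂ, i.e. a (1,0)-local extension of its core ρc, where ρc is the m n × m n compression of ρ to the index pairs (i,j) with i < m. If SN(ρc) ≤ k, then SN(ρ) ≤ k + 1; that is, a (1,0)-local extension cannot increase the Schmidt number by more than one. -/
open Matrix Kronecker ComplexOrder

theorem exists_isometry_of_gram {E : Type*} [NormedAddCommGroup E] [InnerProductSpace ℂ E]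
    [FiniteDimensional ℂ E] {ι : Type*} [Fintype ι] (x y : ι → E)
    (h : ∀ i j, inner ℂ (x i) (x j) = inner ℂ (y i) (y j)) :
    ∃ U : E →ₗᵢ[ℂ] E, ∀ i, U (x i) = y i := by
  classical
  let f := Fintype.linearCombination ℂ x
  let g := Fintype.linearCombination ℂ y
  have hn : ∀ a, ‖g a‖ = ‖f a‖ := by
    intro a
    have : inner ℂ (g a) (g a) = inner ℂ (f a) (f a) := by
      simp only [f, g, Fintype.linearCombination_apply, sum_inner, inner_sum, inner_smul_left,
        inner_smul_right, h]
    rw [@norm_eq_sqrt_re_inner ℂ, @norm_eq_sqrt_re_inner ℂ, this]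
  obtain ⟨r, hr⟩ := f.rangeRestrict.exists_rightInverse_of_surjective f.range_rangeRestrict
  have hfr : ∀ s, f (r s) = (s : E) := fun s =>
    congrArg Subtype.val (LinearMap.congr_fun hr s)
  let L : f.range →ₗᵢ[ℂ] E := ⟨g ∘ₗ r, fun s => by
    simp only [LinearMap.comp_apply, hn, hfr]; rfl⟩
  refine ⟨L.extend, fun i => ?_⟩
  have hx : f (Pi.single i 1) = x i := by simp [f]
  have hy : g (Pi.single i 1) = y i := by simp [g]
  have hm : x i ∈ f.range := ⟨_, hx⟩
  have h1 : L.extend (x i) = L ⟨x i, hm⟩ := L.extend_apply ⟨x i, hm⟩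
  rw [h1]
  change g (r ⟨x i, hm⟩) = y i
  rw [← hy, ← sub_eq_zero, ← map_sub, ← norm_eq_zero, hn, map_sub, hfr, hx]
  simp

theorem schmidtRank_succ_le {m n : ℕ} (z : Fin (m + 1) × Fin n → ℂ) :
    schmidtRank z ≤ schmidtRank (fun p : Fin m × Fin n => z (p.1.castSucc, p.2)) + 1 := by
  unfold schmidtRank
  rw [Matrix.rank_eq_finrank_span_row, Matrix.rank_eq_finrank_span_row]
  set A : Set (Fin n → ℂ) := Set.range (Matrix.of fun (i : Fin m) j => z (i.castSucc, j)).row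
  have hle : Submodule.span ℂ (Set.range (Matrix.of fun i j => z (i, j)).row) ≤
      Submodule.span ℂ A ⊔ Submodule.span ℂ {fun j => z (Fin.last m, j)} := by
    rw [Submodule.span_le]
    rintro _ ⟨i, rfl⟩
    induction i using Fin.lastCases with
    | last => exact Submodule.mem_sup_right (Submodule.subset_span rfl)
    | cast i => exact Submodule.mem_sup_left (Submodule.subset_span ⟨i, rfl⟩)
  refine (Submodule.finrank_mono hle).trans
    ((Submodule.finrank_add_le_finrank_add_finrank _ _).trans ?_)
  gcongr
  exact (finrank_span_le_card _).trans (by simp)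

/-- A (1,0)-local extension cannot increase the Schmidt number by more than one. -/
theorem local_extension_schmidt_number {m n k : ℕ} (hm : 1 ≤ m) (hn : 1 ≤ n)
    (ρ : Matrix (Fin (m + 1) × Fin n) (Fin (m + 1) × Fin n) ℂ) (hρ : ρ.PosSemidef)
    (ρc : Matrix (Fin m × Fin n) (Fin m × Fin n) ℂ)
    (hc : ∀ p q : Fin m × Fin n, ρc p q = ρ (p.1.castSucc, p.2) (q.1.castSucc, q.2))
    (hSN : SNle ρc k) : SNle ρ (k + 1) := by
  obtain ⟨T, v, hv, hvc⟩ := hSN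
  obtain ⟨S, w, hw⟩ := Matrix.posSemidef_iff_eq_sum_vecMulVec.mp hρ
  let x : Fin (m + 1) × Fin n → EuclideanSpace ℂ (Fin S ⊕ Fin T) :=
    fun p => WithLp.toLp 2 (Sum.elim (fun s => w s p) (fun _ => 0))
  let y : Fin m × Fin n → EuclideanSpace ℂ (Fin S ⊕ Fin T) :=
    fun p => WithLp.toLp 2 (Sum.elim (fun _ => 0) (fun t => v t p))
  have hx : ∀ p q, inner ℂ (x q) (x p) = ρ p q := by
    intro p q
    rw [hw]
    simp [x, PiLp.inner_apply, Matrix.sum_apply, Matrix.vecMulVec_apply]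
  have hy : ∀ p q, inner ℂ (y q) (y p) = ρc p q := by
    intro p q
    rw [hvc]
    simp [y, PiLp.inner_apply, Matrix.sum_apply, outer]
  obtain ⟨U, hU⟩ := exists_isometry_of_gram
    (fun p : Fin m × Fin n => x (p.1.castSucc, p.2)) y (fun i j => by rw [hx, hy, hc])
  let e := finSumFinEquiv (m := S) (n := T)
  refine ⟨S + T, fun t p => U (x p) (e.symm t), fun t => ?_, ?_⟩
  · refine (schmidtRank_succ_le _).trans (Nat.add_le_add_right ?_ 1)
    simp only [hU]
    rcases e.symm t with s | t
    · have : (Matrix.of fun (i : Fin m) (j : Fin n) => y (i, j) (Sum.inl s)) = 0 := by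
        ext i j; simp [y]
      simp [schmidtRank, this]
    · exact hv t
  · ext p q
    rw [← hx, ← U.inner_map_map, PiLp.inner_apply, Matrix.sum_apply, ← e.symm.sum_comp]
    simp [outer]
end

section
/- Let ρ be a positive semidefinite matrix indexed by Fin 3 × Fin 4 over ℂ that is PPT, and suppose there exist nonzero vectors a ∈ ℂ^3 and b ∈ ℂ^4 such that ρ annihilates the product vector a ⊗ b (the vector (i,j) ↦ a(i)·b(j)), i.e. ρ (a ⊗ b) = 0. Then SN(ρ) ≤ 2. -/
open Matrix Kronecker ComplexOrder

theorem winding_aux (g : ℂ → ℂ) (hg : Continuous g) (h0 : ∀ z, g z ≠ 0)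
    (H : ℂ → ℂ) (hH : Continuous H) (H0 : H 0 = 1)
    (hgH : ∀ z, z ≠ 0 → g z = z * z * (starRingEnd ℂ z) * H z⁻¹) : False := by
  obtain ⟨F, hFc, hF⟩ := Complex.exists_continuousOn_eqOn_exp_comp (X := ℂ) (U := Set.univ)
    (by
      have : SimplyConnectedSpace (Set.univ : Set ℂ) :=
        (Homeomorph.Set.univ ℂ).toHomotopyEquiv.simplyConnectedSpace
      exact this) isOpen_univ
    (g := g) hg.continuousOn (by rintro ⟨z, -, hz⟩; exact h0 z hz)
  rw [continuousOn_univ] at hFc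
  have hF' : ∀ z, Complex.exp (F z) = g z := fun z => hF (Set.mem_univ z)
  obtain ⟨δ, hδ, hb⟩ := Metric.continuous_iff.mp hH 0 1 one_pos
  set R : ℝ := 2 / δ with hR
  have hRpos : 0 < R := by positivity
  let b : ℝ → ℂ := fun θ => R * Complex.exp (θ * Complex.I)
  have hbc : Continuous b := by fun_prop
  have hb0 : ∀ θ, b θ ≠ 0 := fun θ => by
    simp [b, hRpos.ne', Complex.exp_ne_zero]
  have hnorm : ∀ θ, ‖b θ‖ = R := fun θ => by
    simp [b, Complex.norm_exp_ofReal_mul_I, abs_of_pos hRpos]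
  have hinv : ∀ θ, ‖H (b θ)⁻¹ - 1‖ < 1 := fun θ => by
    have := hb (b θ)⁻¹ (by
      rw [dist_zero_right, norm_inv, hnorm, hR, inv_div]; linarith)
    rwa [H0, dist_eq_norm] at this
  have hslit : ∀ θ, H (b θ)⁻¹ ∈ Complex.slitPlane := fun θ => by
    have := Complex.mem_slitPlane_of_norm_lt_one (hinv θ)
    simpa using this
  let φ : ℝ → ℂ := fun θ => F (b θ) - θ * Complex.I - Complex.log (H (b θ)⁻¹) - 3 * Real.log R
  have hφc : Continuous φ := by
    have h1 : Continuous fun θ => Complex.log (H (b θ)⁻¹) := by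
      apply Continuous.clog _ hslit
      exact hH.comp (hbc.inv₀ hb0)
    have h2 : Continuous fun θ => F (b θ) := hFc.comp hbc
    exact ((h2.sub (by fun_prop)).sub h1).sub continuous_const
  have hexp : ∀ θ, Complex.exp (φ θ) = 1 := fun θ => by
    have hne : H (b θ)⁻¹ ≠ 0 := Complex.slitPlane_ne_zero (hslit θ)
    have hconj : starRingEnd ℂ (b θ) = R * (Complex.exp (θ * Complex.I))⁻¹ := by
      simp only [b, map_mul, Complex.conj_ofReal, ← Complex.exp_conj, Complex.conj_I,
        mul_neg, Complex.exp_neg]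
    have hlog : Complex.exp (3 * Real.log R) = (R : ℂ) ^ 3 := by
      have : (3 : ℂ) * Real.log R = ((3 : ℕ) : ℂ) * (Real.log R : ℂ) := by norm_num
      rw [this, Complex.exp_nat_mul, ← Complex.ofReal_exp, Real.exp_log hRpos]
    simp only [φ, Complex.exp_sub]
    rw [hF', hgH _ (hb0 θ), Complex.exp_log hne, hlog, hconj]
    have hR' : (R : ℂ) ≠ 0 := by exact_mod_cast hRpos.ne'
    have he := Complex.exp_ne_zero (θ * Complex.I)
    generalize H (b θ)⁻¹ = h at hne ⊢
    simp only [b]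
    field_simp
  have hre : ∀ θ, (φ θ).re = 0 := fun θ => by
    have := congrArg norm (hexp θ)
    rwa [Complex.norm_exp, norm_one, Real.exp_eq_one_iff] at this
  have hb2 : b (2 * Real.pi) = b 0 := by
    simp [b, Complex.exp_two_pi_mul_I]
  have hend : φ (2 * Real.pi) = φ 0 - 2 * Real.pi * Complex.I := by
    simp only [φ, hb2]; push_cast; ring
  have hmem : (φ 0).im - Real.pi ∈ Set.Icc ((φ (2 * Real.pi)).im) ((φ 0).im) := by
    rw [hend]
    constructor <;> simp <;> linarith [Real.pi_pos]
  obtain ⟨θ, -, hθ⟩ := intermediate_value_Icc' (a := 0) (b := 2 * Real.pi) (by positivity)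
    ((Complex.continuous_im.comp hφc).continuousOn) hmem
  have : φ θ = φ 0 - Real.pi * Complex.I := by
    apply Complex.ext
    · simp [hre]
    · simpa using hθ
  have h1 := hexp θ
  rw [this, Complex.exp_sub, hexp, Complex.exp_pi_mul_I] at h1
  norm_num at h1

theorem exists_det_zero (K : Matrix (Fin 3) (Fin 3) ℂ) :
    ∃ z : ℂ, (diagonal ![z, z, starRingEnd ℂ z] - K).det = 0 := by
  by_contra hcon
  push Not at hcon
  refine winding_aux (fun z => (diagonal ![z, z, starRingEnd ℂ z] - K).det) ?_ hcon
    (fun e => (1 - diagonal ![e, e, starRingEnd ℂ e] * K).det) ?_ ?_ ?_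
  · have : Continuous (starRingEnd ℂ) := Complex.continuous_conj
    simp only [det_fin_three, Matrix.sub_apply, diagonal_apply]
    simp; fun_prop
  · have : Continuous (starRingEnd ℂ) := Complex.continuous_conj
    simp only [det_fin_three, Matrix.sub_apply, diagonal_mul]
    simp; fun_prop
  · have : (diagonal ![(0:ℂ), 0, starRingEnd ℂ 0] : Matrix (Fin 3) (Fin 3) ℂ) = 0 := by
      ext i j; fin_cases i <;> fin_cases j <;> simp
    simp only [this]; simp
  · intro z hz
    have hz' : starRingEnd ℂ z ≠ 0 := by simpa using hz
    have : diagonal ![z, z, starRingEnd ℂ z] - K = diagonal ![z, z, starRingEnd ℂ z] *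
        (1 - diagonal ![z⁻¹, z⁻¹, starRingEnd ℂ z⁻¹] * K) := by
      rw [mul_sub, ← mul_assoc, diagonal_mul_diagonal, mul_one]
      congr 1
      have : (fun i => ![z, z, starRingEnd ℂ z] i * ![z⁻¹, z⁻¹, starRingEnd ℂ z⁻¹] i) = fun _ => 1 := by
        funext i; fin_cases i <;> simp [hz]
      rw [this, diagonal_one, one_mul]
    simp only [this, det_mul, det_diagonal, Fin.prod_univ_three]
    simp

theorem psd_sub {n : Type} [Fintype n] [DecidableEq n] {M : Matrix n n ℂ} (hM : M.PosSemidef)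
    (x : n → ℂ) (hx : M *ᵥ x ≠ 0) :
    ∃ s : ℝ, 0 < s ∧
      (∀ t : ℝ, t ≤ s → (M - (t : ℂ) • vecMulVec (M *ᵥ x) (star (M *ᵥ x))).PosSemidef) ∧
      (∀ t : ℂ, (M - t • vecMulVec (M *ᵥ x) (star (M *ᵥ x))).rank ≤ M.rank) ∧
      (M - (s : ℂ) • vecMulVec (M *ᵥ x) (star (M *ᵥ x))).rank < M.rank ∧
      (M - (s : ℂ) • vecMulVec (M *ᵥ x) (star (M *ᵥ x))) *ᵥ x = 0 := by
  have hH : Mᴴ = M := hM.1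
  set w := M *ᵥ x with hw
  have hq0 : 0 ≤ star x ⬝ᵥ w := hM.dotProduct_mulVec_nonneg x
  have hqne : star x ⬝ᵥ w ≠ 0 := fun h => hx ((hM.dotProduct_mulVec_zero_iff x).mp h)
  obtain ⟨r, hr⟩ : ∃ r : ℝ, star x ⬝ᵥ w = r := ⟨_, (Complex.eq_re_of_ofReal_le hq0)⟩
  have hrpos : 0 < r := by
    have : (0:ℂ) < r := hr ▸ lt_of_le_of_ne hq0 hqne.symm
    exact_mod_cast this
  have hwx : star w ⬝ᵥ x = r := by
    have : star (star x ⬝ᵥ w) = star w ⬝ᵥ x := by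
      rw [star_dotProduct, star_star]
    rw [← this, hr]; simp
  have hsw : star w = star x ᵥ* M := by
    rw [hw, star_mulVec, hH]
  have hfac : ∀ t : ℂ, M - t • vecMulVec w (star w) = M * (1 - t • vecMulVec x (star w)) := by
    intro t
    rw [mul_sub, mul_one, mul_smul_comm, mul_vecMulVec]
  have hzero : (M - ((r⁻¹ : ℝ) : ℂ) • vecMulVec w (star w)) *ᵥ x = 0 := by
    rw [sub_mulVec, smul_mulVec, vecMulVec_mulVec, hwx, ← hw]
    ext i
    have : (r : ℂ) ≠ 0 := by exact_mod_cast hrpos.ne'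
    simp; field_simp; simp
  refine ⟨r⁻¹, inv_pos.mpr hrpos, ?_, ?_, ?_, hzero⟩
  · intro t ht
    have h1 : (M - ((r⁻¹ : ℝ) : ℂ) • vecMulVec w (star w)).PosSemidef := by
      have := hM.conjTranspose_mul_mul_same (1 - ((r⁻¹ : ℝ) : ℂ) • vecMulVec x (star w))
      convert this using 1
      rw [mul_assoc, ← hfac, conjTranspose_sub, conjTranspose_one, sub_mul, one_mul,
        conjTranspose_smul, conjTranspose_vecMulVec, star_star, smul_mul_assoc,
        vecMulVec_mul]
      have : star x ᵥ* (M - ((r⁻¹ : ℝ) : ℂ) • vecMulVec w (star w)) = 0 := by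
        have h2 := congrArg star hzero
        rw [star_mulVec, star_zero] at h2
        rw [← h2]; congr 1
        rw [conjTranspose_sub, hH, conjTranspose_smul, conjTranspose_vecMulVec, star_star]
        simp
      rw [this]; simp
    have h2 : (((r⁻¹ - t : ℝ) : ℂ) • vecMulVec w (star w)).PosSemidef := by
      apply (posSemidef_vecMulVec_self_star w).smul
      exact_mod_cast sub_nonneg.mpr ht
    convert h1.add h2 using 1
    push_cast
    rw [sub_smul]; abel
  · intro t; rw [hfac]; exact rank_mul_le_left _ _
  · have hlt : LinearMap.ker M.mulVecLin <
        LinearMap.ker (M - ((r⁻¹ : ℝ) : ℂ) • vecMulVec w (star w)).mulVecLin := by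
      refine lt_of_le_of_ne ?_ ?_
      · intro z hz
        rw [LinearMap.mem_ker, mulVecLin_apply] at hz ⊢
        rw [sub_mulVec, smul_mulVec, vecMulVec_mulVec, hz, hsw, ← dotProduct_mulVec, hz]
        simp
      · intro h
        have : x ∈ LinearMap.ker M.mulVecLin := by
          rw [h, LinearMap.mem_ker, mulVecLin_apply]; exact hzero
        rw [LinearMap.mem_ker, mulVecLin_apply] at this
        exact hx this
    have h1 := Submodule.finrank_lt_finrank_of_lt hlt
    have h2 := LinearMap.finrank_range_add_finrank_ker M.mulVecLin
    have h3 := LinearMap.finrank_range_add_finrank_ker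
      (M - ((r⁻¹ : ℝ) : ℂ) • vecMulVec w (star w)).mulVecLin
    unfold rank
    omega

/-- separability of a `2 × n` block matrix -/
inductive BSep {n : Type} : Matrix n n ℂ → Matrix n n ℂ → Matrix n n ℂ → Prop
  | zero : BSep 0 0 0
  | cons {A B C : Matrix n n ℂ} (α β : ℂ) (y : n → ℂ) (h : BSep A B C) :
      BSep (A + (α * star α) • vecMulVec y (star y)) (B + (α * star β) • vecMulVec y (star y))
        (C + (β * star β) • vecMulVec y (star y))

theorem BSep.conj {n m : Type} [Fintype n] {A B C : Matrix n n ℂ} (h : BSep A B C)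
    (V : Matrix m n ℂ) : BSep (V * A * Vᴴ) (V * B * Vᴴ) (V * C * Vᴴ) := by
  induction h with
  | zero => simpa using BSep.zero
  | cons α β y h ih =>
    have := BSep.cons α β (V *ᵥ y) ih
    convert this using 1 <;>
    · rw [Matrix.mul_add, Matrix.add_mul, Matrix.mul_smul, Matrix.smul_mul, mul_vecMulVec, vecMulVec_mul,
        star_mulVec]

def BPPT {n : Type} (A B C : Matrix n n ℂ) : Prop :=
  (fromBlocks A B Bᴴ C).PosSemidef ∧ (fromBlocks A Bᴴ B C).PosSemidef

def HasPV {n : Type} [Fintype n] (A B C : Matrix n n ℂ) : Prop :=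
  ∃ (α β : ℂ) (y : n → ℂ), (Sum.elim (α • y) (β • y) : n ⊕ n → ℂ) ≠ 0 ∧
    (∃ x, fromBlocks A B Bᴴ C *ᵥ x = Sum.elim (α • y) (β • y)) ∧
    (∃ x, fromBlocks A Bᴴ B C *ᵥ x = Sum.elim (star α • y) (star β • y))

theorem outer_blocks {n : Type} (α β : ℂ) (y : n → ℂ) :
    vecMulVec (Sum.elim (α • y) (β • y) : n ⊕ n → ℂ) (star (Sum.elim (α • y) (β • y))) =
    fromBlocks ((α * star α) • vecMulVec y (star y)) ((α * star β) • vecMulVec y (star y))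
     ((β * star α) • vecMulVec y (star y)) ((β * star β) • vecMulVec y (star y)) := by
  ext (i | i) (j | j) <;> simp [vecMulVec_apply] <;> ring

theorem HasPV.step {n : Type} [Fintype n] [DecidableEq n] {A B C : Matrix n n ℂ}
    (h : BPPT A B C) (hp : HasPV A B C) : ∃ A' B' C' : Matrix n n ℂ, BPPT A' B' C' ∧
      (fromBlocks A' B' B'ᴴ C').rank + (fromBlocks A' B'ᴴ B' C').rank <
        (fromBlocks A B Bᴴ C).rank + (fromBlocks A Bᴴ B C).rank ∧
      (BSep A' B' C' → BSep A B C) := by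
  obtain ⟨α, β, y, hne, ⟨x, hx⟩, ⟨x', hx'⟩⟩ := hp
  have hne' : (Sum.elim (star α • y) (star β • y) : n ⊕ n → ℂ) ≠ 0 := by
    intro h0
    apply hne
    ext (i | i)
    · have := congrFun h0 (Sum.inl i); simpa using this
    · have := congrFun h0 (Sum.inr i); simpa using this
  obtain ⟨s, hs, hs1, hs2, hs3, -⟩ := psd_sub h.1 x (by rw [hx]; exact hne)
  obtain ⟨s', hs', hs1', hs2', hs3', -⟩ := psd_sub h.2 x' (by rw [hx']; exact hne')
  rw [hx, outer_blocks] at hs1 hs2 hs3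
  rw [hx', outer_blocks] at hs1' hs2' hs3'
  set t := min s s' with ht
  have ht0 : 0 < t := lt_min hs hs'
  set Y := vecMulVec y (star y) with hY
  have hYH : Yᴴ = Y := by rw [hY, conjTranspose_vecMulVec, star_star]
  have key : ∀ t : ℝ, fromBlocks A B Bᴴ C - (t : ℂ) • fromBlocks ((α * star α) • Y) ((α * star β) • Y)
      ((β * star α) • Y) ((β * star β) • Y) =
      fromBlocks (A - ((t : ℂ) * (α * star α)) • Y) (B - ((t : ℂ) * (α * star β)) • Y)
       (B - ((t : ℂ) * (α * star β)) • Y)ᴴ (C - ((t : ℂ) * (β * star β)) • Y) := by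
    intro t
    rw [fromBlocks_smul, sub_eq_add_neg, fromBlocks_neg, fromBlocks_add]
    simp only [smul_smul, ← sub_eq_add_neg, conjTranspose_sub, conjTranspose_smul, hYH]
    congr 3
    simp only [star_mul', Complex.star_def, Complex.conj_ofReal, Complex.conj_conj]; ring
  have key' : ∀ t : ℝ, fromBlocks A Bᴴ B C - (t : ℂ) • fromBlocks ((star α * star (star α)) • Y)
      ((star α * star (star β)) • Y)
      ((star β * star (star α)) • Y) ((star β * star (star β)) • Y) =
      fromBlocks (A - ((t : ℂ) * (α * star α)) • Y) (B - ((t : ℂ) * (α * star β)) • Y)ᴴ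
       (B - ((t : ℂ) * (α * star β)) • Y) (C - ((t : ℂ) * (β * star β)) • Y) := by
    intro t
    rw [fromBlocks_smul, sub_eq_add_neg, fromBlocks_neg, fromBlocks_add]
    simp only [smul_smul, ← sub_eq_add_neg, conjTranspose_sub, conjTranspose_smul, hYH]
    congr 3 <;> (simp only [star_mul', Complex.star_def, Complex.conj_ofReal, Complex.conj_conj]; try ring)
  refine ⟨A - ((t : ℂ) * (α * star α)) • Y, B - ((t : ℂ) * (α * star β)) • Y,
    C - ((t : ℂ) * (β * star β)) • Y, ⟨?_, ?_⟩, ?_, ?_⟩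
  · rw [← key]; exact hs1 t (min_le_left _ _)
  · rw [← key']; exact hs1' t (min_le_right _ _)
  · rw [← key, ← key']
    have a1 := hs2 t
    have a2 := hs2' t
    rcases min_choice s s' with h1 | h1
    · have a3 : t = s := h1
      rw [a3] at a1 a2 ⊢; omega
    · have a3 : t = s' := h1
      rw [a3] at a1 a2 ⊢; omega
  · intro hS
    have := BSep.cons α β ((Real.sqrt t : ℂ) • y) hS
    have hsq : (Real.sqrt t : ℂ) * (Real.sqrt t : ℂ) = t := by
      rw [← Complex.ofReal_mul, Real.mul_self_sqrt ht0.le]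
    have hYt : vecMulVec ((Real.sqrt t : ℂ) • y) (star ((Real.sqrt t : ℂ) • y)) = (t : ℂ) • Y := by
      rw [star_smul, smul_vecMulVec, vecMulVec_smul, smul_smul, ← hsq, hY]
      simp
    rw [hYt] at this
    simp only [smul_smul] at this
    convert this using 1 <;>
    · rw [mul_comm (t : ℂ)]; simp

theorem exists_unitary {d : ℕ} (y : Fin (d+1) → ℂ) (hy : y ≠ 0) :
    ∃ U : Matrix (Fin (d+1)) (Fin (d+1)) ℂ, U * Uᴴ = 1 ∧ Uᴴ * U = 1 ∧
      ∃ c : ℂ, c ≠ 0 ∧ ∀ i, U i 0 = c * y i := by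
  let w : EuclideanSpace ℂ (Fin (d+1)) := WithLp.toLp 2 y
  have hw : w ≠ 0 := by
    intro h; apply hy
    have := congrArg WithLp.ofLp h
    simpa [w] using this
  let c : ℂ := ((‖w‖⁻¹ : ℝ) : ℂ)
  have hc : c ≠ 0 := by
    simp only [c]; exact_mod_cast inv_ne_zero (norm_ne_zero_iff.mpr hw)
  obtain ⟨b, hb⟩ := Orthonormal.exists_orthonormalBasis_extension_of_card_eq (𝕜 := ℂ)
    (E := EuclideanSpace ℂ (Fin (d+1))) (ι := Fin (d+1)) (by simp)
    (v := fun _ => c • w) (s := {0}) (by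
      rw [orthonormal_iff_ite]
      rintro ⟨i, hi⟩ ⟨j, hj⟩
      obtain rfl : i = 0 := hi
      obtain rfl : j = 0 := hj
      simp only [Set.domRestrict_apply, if_true]
      rw [inner_self_eq_norm_sq_to_K, norm_smul]
      have : ‖c‖ = ‖w‖⁻¹ := by simp [c]
      rw [this, inv_mul_cancel₀ (norm_ne_zero_iff.mpr hw)]; simp)
  have hU : (Matrix.of fun i j => b j i : Matrix (Fin (d+1)) (Fin (d+1)) ℂ)ᴴ *
      (Matrix.of fun i j => b j i) = 1 := by
    ext i j
    have := orthonormal_iff_ite.mp b.orthonormal i j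
    rw [PiLp.inner_apply] at this
    simp only [Matrix.mul_apply, conjTranspose_apply, Matrix.of_apply, Matrix.one_apply]
    rw [← this]
    apply Finset.sum_congr rfl
    intro k _
    simp [mul_comm]
  refine ⟨Matrix.of fun i j => b j i, mul_eq_one_comm.mp hU, hU, c, hc, ?_⟩
  intro i
  simp [hb 0 rfl, w]

theorem exists_isom {d : ℕ} (y : Fin (d+1) → ℂ) (hy : y ≠ 0) :
    ∃ V : Matrix (Fin (d+1)) (Fin d) ℂ, ∃ c : ℂ, V * Vᴴ = 1 - c • vecMulVec y (star y) := by
  obtain ⟨U, hU, -, c, hc, h⟩ := exists_unitary y hy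
  refine ⟨Matrix.of fun i j => U i j.succ, c * star c, ?_⟩
  rw [← hU]
  ext i j
  simp only [Matrix.mul_apply, Matrix.sub_apply, Fin.sum_univ_succ, conjTranspose_apply, h,
    Matrix.smul_apply, vecMulVec_apply, Matrix.of_apply, Pi.star_apply, smul_eq_mul, star_mul']
  ring

theorem isom_conj {d : ℕ} {y : Fin (d+1) → ℂ} {V : Matrix (Fin (d+1)) (Fin d) ℂ} {c : ℂ}
    (hV : V * Vᴴ = 1 - c • vecMulVec y (star y)) (M : Matrix (Fin (d+1)) (Fin (d+1)) ℂ)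
    (h1 : M *ᵥ y = 0) (h2 : Mᴴ *ᵥ y = 0) : V * (Vᴴ * M * V) * Vᴴ = M := by
  have e : V * (Vᴴ * M * V) * Vᴴ = (V * Vᴴ) * M * (V * Vᴴ) := by
    simp only [Matrix.mul_assoc]
  have h3 : star y ᵥ* M = 0 := by
    have := congrArg star h2
    rwa [star_mulVec, conjTranspose_conjTranspose, star_zero] at this
  rw [e, hV, Matrix.sub_mul, Matrix.one_mul, Matrix.smul_mul, vecMulVec_mul, h3, Matrix.mul_sub,
    Matrix.mul_smul, mul_vecMulVec]
  simp [h1]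

theorem BPPT.conj {n m : Type} [Fintype n] [Fintype m] {A B C : Matrix n n ℂ} (h : BPPT A B C)
    (V : Matrix n m ℂ) : BPPT (Vᴴ * A * V) (Vᴴ * B * V) (Vᴴ * C * V) ∧
    (fromBlocks (Vᴴ * A * V) (Vᴴ * B * V) (Vᴴ * B * V)ᴴ (Vᴴ * C * V)).rank ≤ 
      (fromBlocks A B Bᴴ C).rank ∧
    (fromBlocks (Vᴴ * A * V) (Vᴴ * B * V)ᴴ (Vᴴ * B * V) (Vᴴ * C * V)).rank ≤ 
      (fromBlocks A Bᴴ B C).rank := by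
  have e : ∀ X Y : Matrix n n ℂ, (fromBlocks V 0 0 V)ᴴ * (fromBlocks A X Y C) * (fromBlocks V 0 0 V)
      = fromBlocks (Vᴴ * A * V) (Vᴴ * X * V) (Vᴴ * Y * V) (Vᴴ * C * V) := by
    intro X Y
    simp [fromBlocks_conjTranspose, fromBlocks_multiply]
  have eB : (Vᴴ * B * V)ᴴ = Vᴴ * Bᴴ * V := by
    simp [conjTranspose_mul, Matrix.mul_assoc]
  unfold BPPT
  rw [eB, ← e, ← e]
  refine ⟨⟨h.1.conjTranspose_mul_mul_same _, h.2.conjTranspose_mul_mul_same _⟩, ?_, ?_⟩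
  · exact (rank_mul_le_left _ _).trans (rank_mul_le_right _ _)
  · exact (rank_mul_le_left _ _).trans (rank_mul_le_right _ _)

theorem psd_kill {n : Type} [Fintype n] [DecidableEq n] {A B C : Matrix n n ℂ}
    (h : (fromBlocks A B Bᴴ C).PosSemidef) (y : n → ℂ) (hy : A *ᵥ y = 0) : Bᴴ *ᵥ y = 0 := by
  have h1 := (h.dotProduct_mulVec_zero_iff (Sum.elim y 0)).mp (by
    rw [fromBlocks_mulVec]
    simp [hy, dotProduct])
  rw [fromBlocks_mulVec] at h1
  funext i
  simpa using congrFun h1 (Sum.inr i)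

theorem singular_step {d : ℕ}
    (IH : ∀ A B C : Matrix (Fin d) (Fin d) ℂ, BPPT A B C → BSep A B C)
    (A B C : Matrix (Fin (d+1)) (Fin (d+1)) ℂ) (h : BPPT A B C)
    (y : Fin (d+1) → ℂ) (hy : y ≠ 0) (hA : A *ᵥ y = 0) : BSep A B C := by
  have hB' : Bᴴ *ᵥ y = 0 := psd_kill h.1 y hA
  have hB : B *ᵥ y = 0 := by
    have := psd_kill (B := Bᴴ) (C := C) (A := A) (by rw [conjTranspose_conjTranspose]; exact h.2) y hA
    rwa [conjTranspose_conjTranspose] at this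
  have hAH : Aᴴ = A := by
    have := h.1.1
    rw [IsHermitian, fromBlocks_conjTranspose] at this
    exact (fromBlocks_inj.mp this).1
  have hCH : Cᴴ = C := by
    have := h.1.1
    rw [IsHermitian, fromBlocks_conjTranspose] at this
    exact (fromBlocks_inj.mp this).2.2.2
  obtain ⟨V, c, hV⟩ := exists_isom y hy
  have main : ∀ C' : Matrix (Fin (d+1)) (Fin (d+1)) ℂ, BPPT A B C' → C'ᴴ = C' → C' *ᵥ y = 0 →
      BSep A B C' := by
    intro C' h' hH hC'
    have := (IH _ _ _ (h'.conj V).1).conj V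
    rwa [isom_conj hV A hA (by rw [hAH, hA]), isom_conj hV B hB hB',
      isom_conj hV C' hC' (by rw [hH, hC'])] at this
  by_cases hC : C *ᵥ y = 0
  · exact main C h hCH hC
  have e1 : ∀ X Y : Matrix (Fin (d+1)) (Fin (d+1)) ℂ, X *ᵥ y = 0 →
      fromBlocks A X Y C *ᵥ (Sum.elim 0 y) = (Sum.elim 0 (C *ᵥ y) : Fin (d+1) ⊕ Fin (d+1) → ℂ) := by
    intro X Y hX
    rw [fromBlocks_mulVec]; simp [hX]
  have hne : (Sum.elim 0 (C *ᵥ y) : Fin (d+1) ⊕ Fin (d+1) → ℂ) ≠ 0 := by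
    intro h0; apply hC; funext i; simpa using congrFun h0 (Sum.inr i)
  obtain ⟨s, hs, hs1, -, -, hs0⟩ := psd_sub h.1 (Sum.elim 0 y) (by rw [e1 _ _ hB]; exact hne)
  obtain ⟨s', hs', hs1', -, -, hs0'⟩ := psd_sub h.2 (Sum.elim 0 y) (by rw [e1 _ _ hB']; exact hne)
  rw [e1 _ _ hB] at hs1 hs0
  rw [e1 _ _ hB'] at hs1' hs0'
  have e2 : ∀ (t : ℂ) (X Y : Matrix (Fin (d+1)) (Fin (d+1)) ℂ), fromBlocks A X Y C -
      t • vecMulVec (Sum.elim 0 (C *ᵥ y) : Fin (d+1) ⊕ Fin (d+1) → ℂ)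
        (star (Sum.elim 0 (C *ᵥ y) : Fin (d+1) ⊕ Fin (d+1) → ℂ)) =
      fromBlocks A X Y (C - t • vecMulVec (C *ᵥ y) (star (C *ᵥ y))) := by
    intro t X Y
    ext (i | i) (j | j) <;> simp [vecMulVec_apply]
  simp only [e2] at hs1 hs0 hs1' hs0'
  have z : (C - (s:ℂ) • vecMulVec (C *ᵥ y) (star (C *ᵥ y))) *ᵥ y = 0 := by
    rw [fromBlocks_mulVec] at hs0
    funext i; simpa using congrFun hs0 (Sum.inr i)
  have z' : (C - (s':ℂ) • vecMulVec (C *ᵥ y) (star (C *ᵥ y))) *ᵥ y = 0 := by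
    rw [fromBlocks_mulVec] at hs0'
    funext i; simpa using congrFun hs0' (Sum.inr i)
  have hss : s = s' := by
    by_contra hss
    have h1 : ((s:ℂ) - s') • (vecMulVec (C *ᵥ y) (star (C *ᵥ y)) *ᵥ y) = 0 := by
      rw [sub_mulVec, smul_mulVec] at z z'
      rw [sub_smul]
      rw [sub_eq_zero] at *
      rw [← z, ← z']
    have h2 : (s:ℂ) - s' ≠ 0 := by
      rw [sub_ne_zero]; exact_mod_cast hss
    have h3 := (smul_eq_zero.mp h1).resolve_left h2
    rw [sub_mulVec, smul_mulVec, h3] at z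
    simp at z; exact hC z
  subst hss
  have hf := main (C - (s:ℂ) • vecMulVec (C *ᵥ y) (star (C *ᵥ y)))
    ⟨hs1 s le_rfl, hs1' s le_rfl⟩ (by
      rw [conjTranspose_sub, hCH, conjTranspose_smul, conjTranspose_vecMulVec, star_star]; simp) z
  have := BSep.cons 0 (Real.sqrt s) (C *ᵥ y) hf
  have hsq : (Real.sqrt s : ℂ) * (Real.sqrt s : ℂ) = s := by
    rw [← Complex.ofReal_mul, Real.mul_self_sqrt hs.le]
  simpa [hsq] using this

theorem star_dot {n : Type} [Fintype n] (x y : n → ℂ) : star (star x ⬝ᵥ y) = star y ⬝ᵥ x := by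
  rw [star_dotProduct, star_star]

theorem cayley_tr (D b : Matrix (Fin 2) (Fin 2) ℂ) (hD : Dᴴ = D) (h0 : D.trace = 0)
    (h1 : (D * b).trace = 0) : (D * (b * bᴴ + bᴴ * b)).trace = 0 := by
  have h2 : (D * bᴴ).trace = 0 := by
    have := congrArg star h1
    rw [← trace_conjTranspose, conjTranspose_mul, hD, trace_mul_comm] at this
    simpa using this
  have key : b * bᴴ + bᴴ * b = bᴴ.trace • b + b.trace • bᴴ +
      ((b * bᴴ).trace - b.trace * bᴴ.trace) • (1 : Matrix (Fin 2) (Fin 2) ℂ) := by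
    ext i j
    fin_cases i <;> fin_cases j <;>
      simp [Matrix.trace, Matrix.mul_apply, Fin.sum_univ_two] <;> ring
  rw [key]
  simp [Matrix.mul_add, h0, h1, h2]

theorem tr_zero {n : Type} [Fintype n] {b : Matrix n n ℂ} {p q : n → ℂ} (h : bᴴ *ᵥ p = b *ᵥ q)
    (hpq : star p ⬝ᵥ p = star q ⬝ᵥ q) :
    (vecMulVec p (star p) - vecMulVec q (star q)).trace = 0 ∧
    ((vecMulVec p (star p) - vecMulVec q (star q)) * b).trace = 0 := by
  constructor
  · rw [trace_sub, trace_vecMulVec, trace_vecMulVec, dotProduct_comm, hpq, dotProduct_comm, sub_self]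
  · rw [Matrix.sub_mul, trace_sub, vecMulVec_mul, vecMulVec_mul, trace_vecMulVec, trace_vecMulVec]
    have h1 : star p ᵥ* b = star (b *ᵥ q) := by
      rw [← h, star_mulVec, conjTranspose_conjTranspose]
    rw [h1, star_mulVec, dotProduct_comm, ← dotProduct_mulVec, h, dotProduct_comm q, 
      ← dotProduct_mulVec, sub_self]

theorem block_tr {n : Type} [Fintype n] {D b : Matrix n n ℂ} {p q : n → ℂ} (h : bᴴ *ᵥ p = b *ᵥ q)
    (hpq : star p ⬝ᵥ p = star q ⬝ᵥ q)
    (h1 : bᴴ * b + vecMulVec q (star q) = b * bᴴ + vecMulVec p (star p) + D) :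
    (D * (b * bᴴ + bᴴ * b + vecMulVec p (star p) + vecMulVec q (star q))).trace = 0 := by
  let M : Matrix (n ⊕ Unit) (n ⊕ Unit) ℂ :=
    fromBlocks b (replicateCol Unit p) (replicateRow Unit (star q)) 0
  have h' : star p ᵥ* b = star q ᵥ* bᴴ := by
    have := congrArg star h
    rwa [star_mulVec, star_mulVec, conjTranspose_conjTranspose] at this
  have e1 : Mᴴ * M = fromBlocks (bᴴ * b + vecMulVec q (star q)) (replicateCol Unit (bᴴ *ᵥ p))
      (replicateRow Unit (star p ᵥ* b)) ((replicateCol Unit p).conjTranspose * replicateCol Unit p) := by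
    simp only [M, fromBlocks_conjTranspose, fromBlocks_multiply]
    simp [conjTranspose_replicateCol, conjTranspose_replicateRow, replicateCol_mulVec,
      replicateRow_vecMul, vecMulVec_eq Unit]
  have e2 : M * Mᴴ = fromBlocks (b * bᴴ + vecMulVec p (star p)) (replicateCol Unit (b *ᵥ q))
      (replicateRow Unit (star q ᵥ* bᴴ)) ((replicateCol Unit q).conjTranspose * replicateCol Unit q) := by
    simp only [M, fromBlocks_conjTranspose, fromBlocks_multiply]
    simp [conjTranspose_replicateCol, conjTranspose_replicateRow, replicateCol_mulVec,
      replicateRow_vecMul, vecMulVec_eq Unit]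
  have e3 : (replicateCol Unit p).conjTranspose * replicateCol Unit p = 
     (replicateCol Unit q).conjTranspose * replicateCol Unit q := by
    ext i j
    simpa [Matrix.mul_apply, dotProduct] using hpq
  have e4 : Mᴴ * M - M * Mᴴ = fromBlocks D 0 0 0 := by
    rw [e1, e2, e3, h, h', h1]
    ext (i | i) (j | j) <;> simp
  have t0 : ((Mᴴ * M - M * Mᴴ) * (M * Mᴴ + Mᴴ * M)).trace = 0 := by
    have a1 : ((Mᴴ * M) * (Mᴴ * M)).trace = ((M * Mᴴ) * (M * Mᴴ)).trace := by
      rw [Matrix.mul_assoc, trace_mul_comm]; simp only [Matrix.mul_assoc]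
    have a2 := trace_mul_comm (Mᴴ * M) (M * Mᴴ)
    rw [Matrix.sub_mul, Matrix.mul_add, Matrix.mul_add, trace_sub, trace_add, trace_add, a1, a2]
    ring
  rw [e4, e1, e2, fromBlocks_add, fromBlocks_multiply] at t0
  simp only [Matrix.zero_mul, add_zero, Matrix.trace, diag_apply, Fintype.sum_sum_type,
    fromBlocks_apply₁₁, fromBlocks_apply₂₂, Matrix.zero_apply, Finset.sum_const_zero] at t0
  have e5 : b * bᴴ + bᴴ * b + vecMulVec p (star p) + vecMulVec q (star q) =
      b * bᴴ + vecMulVec p (star p) + (bᴴ * b + vecMulVec q (star q)) := by abel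
  rw [e5]; exact t0

theorem tr_vv {n : Type} [Fintype n] (v p : n → ℂ) :
    (vecMulVec v (star v) * vecMulVec p (star p)).trace = (star p ⬝ᵥ v) * star (star p ⬝ᵥ v) := by
  rw [vecMulVec_mul_vecMulVec, vecMulVec_smul, trace_smul, trace_vecMulVec, star_dot]
  rw [dotProduct_comm v, smul_eq_mul, mul_comm]

theorem modulus {b : Matrix (Fin 2) (Fin 2) ℂ} {p q u v : Fin 2 → ℂ} {β c : ℂ}
    (h1 : bᴴ * b - b * bᴴ = vecMulVec v (star v) - vecMulVec u (star u) +
      (vecMulVec p (star p) - vecMulVec q (star q)))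
    (h2 : bᴴ *ᵥ p - b *ᵥ q = star β • p - β • q) (hpq : star p ⬝ᵥ p = star q ⬝ᵥ q)
    (h3 : bᴴ *ᵥ v - b *ᵥ u = star c • v - c • u) (huv : star v ⬝ᵥ v = star u ⬝ᵥ u) :
    (star q ⬝ᵥ u) * star (star q ⬝ᵥ u) = (star p ⬝ᵥ v) * star (star p ⬝ᵥ v) := by
  have sh : ∀ (c : ℂ) (p q : Fin 2 → ℂ), bᴴ *ᵥ p - b *ᵥ q = star c • p - c • q →
      (b - c • 1)ᴴ *ᵥ p = (b - c • (1 : Matrix (Fin 2) (Fin 2) ℂ)) *ᵥ q := by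
    intro c p q h
    rw [conjTranspose_sub, conjTranspose_smul, conjTranspose_one, sub_mulVec, sub_mulVec,
      smul_mulVec, smul_mulVec, one_mulVec, one_mulVec]
    rw [sub_eq_sub_iff_sub_eq_sub]; exact h
  have comm : ∀ c : ℂ, (b - c • (1 : Matrix (Fin 2) (Fin 2) ℂ))ᴴ * (b - c • 1) -
      (b - c • 1) * (b - c • (1 : Matrix (Fin 2) (Fin 2) ℂ))ᴴ = bᴴ * b - b * bᴴ := by
    intro c
    simp only [conjTranspose_sub, conjTranspose_smul, conjTranspose_one, Matrix.sub_mul,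
      Matrix.mul_sub, Matrix.smul_mul, Matrix.mul_smul, Matrix.one_mul, Matrix.mul_one,
      smul_sub, smul_smul, mul_comm c]
    abel
  have tsh : ∀ (c c' : ℂ) (D : Matrix (Fin 2) (Fin 2) ℂ), D.trace = 0 →
      (D * (b - c • 1)).trace = 0 → (D * (b - c' • 1)).trace = 0 := by
    intro c c' D h0 h
    simp [Matrix.mul_sub, h0] at h ⊢; exact h
  have HH : ∀ p q : Fin 2 → ℂ, (vecMulVec p (star p) - vecMulVec q (star q))ᴴ =
      vecMulVec p (star p) - vecMulVec q (star q) := by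
    intro p q; simp [conjTranspose_vecMulVec]
  obtain ⟨d0, d1⟩ := tr_zero (sh _ _ _ h3) huv
  obtain ⟨g0, g1⟩ := tr_zero (sh _ _ _ h2) hpq
  have D1 := cayley_tr _ (b - β • 1) (HH v u) d0 (tsh c β _ d0 d1)
  have G1 := cayley_tr _ (b - c • 1) (HH p q) g0 (tsh β c _ g0 g1)
  have D2 := block_tr (D := vecMulVec v (star v) - vecMulVec u (star u)) (sh _ _ _ h2) hpq (by
    have := comm β
    rw [h1, sub_eq_iff_eq_add] at this
    rw [this]; abel)
  have G2 := block_tr (D := vecMulVec p (star p) - vecMulVec q (star q)) (sh _ _ _ h3) huv (by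
    have := comm c
    rw [h1, sub_eq_iff_eq_add] at this
    rw [this]; abel)
  rw [add_assoc, Matrix.mul_add, trace_add, D1, zero_add, Matrix.mul_add, Matrix.sub_mul, Matrix.sub_mul,
    trace_add, trace_sub, trace_sub, tr_vv, tr_vv, tr_vv, tr_vv] at D2
  rw [add_assoc, Matrix.mul_add, trace_add, G1, zero_add, Matrix.mul_add, Matrix.sub_mul, Matrix.sub_mul,
    trace_add, trace_sub, trace_sub, tr_vv, tr_vv, tr_vv, tr_vv] at G2
  have sw : ∀ x y : Fin 2 → ℂ, (star x ⬝ᵥ y) * star (star x ⬝ᵥ y) = (star y ⬝ᵥ x) * star (star y ⬝ᵥ x) := by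
    intro x y
    have : star (star x ⬝ᵥ y) = star y ⬝ᵥ x := by rw [star_dotProduct, star_star]
    rw [← this, star_star, mul_comm]
  rw [sw v p, sw v q, sw u p, sw u q] at G2
  linear_combination -(G2 + D2) / 2

theorem two_solve (b : Matrix (Fin 2) (Fin 2) ℂ) (u v : Fin 2 → ℂ)
    (hδ : u 0 * v 1 - u 1 * v 0 ≠ 0) (huv : star v ⬝ᵥ v = star u ⬝ᵥ u)
    (hb : star v ⬝ᵥ (b *ᵥ v) = star u ⬝ᵥ (b *ᵥ u)) :
    ∃ c : ℂ, b *ᵥ u - bᴴ *ᵥ v = c • u - star c • v := by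
  have hN : star (star u ⬝ᵥ u) = star u ⬝ᵥ u := star_dot u u
  have hg : star (star u ⬝ᵥ v) = star v ⬝ᵥ u := by rw [star_dotProduct, star_star]
  set N := star u ⬝ᵥ u with hNd
  set g := star u ⬝ᵥ v with hgd
  have hdet : N * N - g * star g = (u 0 * v 1 - u 1 * v 0) * star (u 0 * v 1 - u 1 * v 0) := by
    have : N * N = (star u ⬝ᵥ u) * (star v ⬝ᵥ v) := by rw [huv]
    rw [this, hg, hgd]
    simp [dotProduct, Fin.sum_univ_two]
    ring
  have hdet0 : N * N - g * star g ≠ 0 := by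
    rw [hdet]; exact mul_ne_zero hδ (star_ne_zero.mpr hδ)
  let κ := star u ⬝ᵥ (b *ᵥ u - bᴴ *ᵥ v)
  let c := (N * κ + g * star κ) / (N * N - g * star g)
  have hsc : star c = (N * star κ + star g * κ) / (N * N - g * star g) := by
    simp only [c, star_div₀, star_add, star_mul', star_sub, star_star, hN]
    rw [mul_comm (star g) g]
  have e1 : c * N - star c * g = κ := by
    rw [hsc]; simp only [c]
    rw [div_mul_eq_mul_div, div_mul_eq_mul_div, ← sub_div, div_eq_iff hdet0]; ring
  refine ⟨c, ?_⟩
  have z1 : star u ⬝ᵥ (b *ᵥ u - bᴴ *ᵥ v - (c • u - star c • v)) = 0 := by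
    have e1' : c * N - star c * g = star u ⬝ᵥ (b *ᵥ u) - star u ⬝ᵥ (bᴴ *ᵥ v) := by
      rw [e1]; exact dotProduct_sub _ _ _
    simp only [dotProduct_sub, dotProduct_smul, smul_eq_mul, ← hNd, ← hgd]
    rw [e1']; ring
  have z2 : star v ⬝ᵥ (b *ᵥ u - bᴴ *ᵥ v - (c • u - star c • v)) = 0 := by
    have e2 := congrArg star e1
    have e3 : star κ = star u ⬝ᵥ (b *ᵥ u) - star v ⬝ᵥ (b *ᵥ u) + 
        (star (star u ⬝ᵥ (b *ᵥ u)) - star u ⬝ᵥ (b *ᵥ u)) := by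
      simp only [κ]
      rw [dotProduct_sub, star_sub]
      have : star (star u ⬝ᵥ (bᴴ *ᵥ v)) = star v ⬝ᵥ (b *ᵥ u) := by
        rw [star_dotProduct, star_star, star_mulVec, conjTranspose_conjTranspose, dotProduct_mulVec]
      rw [this]; ring
    have e4 : star v ⬝ᵥ (bᴴ *ᵥ v) = star (star u ⬝ᵥ (b *ᵥ u)) := by
      rw [← hb, star_dot, star_mulVec, dotProduct_mulVec]
    simp only [dotProduct_sub, dotProduct_smul, smul_eq_mul, ← hg, huv, e4]
    rw [e3] at e2
    simp only [star_sub, star_mul', star_star, hN] at e2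
    clear_value c N g κ
    linear_combination e2
  simp only [dotProduct, Fin.sum_univ_two, Pi.star_apply] at z1 z2
  have hδ' : star (u 0) * star (v 1) - star (u 1) * star (v 0) ≠ 0 := by
    have := star_ne_zero.mpr hδ
    simpa only [star_sub, star_mul'] using this
  rw [← sub_eq_zero]
  set z := b *ᵥ u - bᴴ *ᵥ v - (c • u - star c • v)
  funext i
  fin_cases i
  · apply (mul_eq_zero.mp (_ : _ * z 0 = 0)).resolve_left hδ'
    linear_combination star (v 1) * z1 - star (u 1) * z2
  · apply (mul_eq_zero.mp (_ : _ * z 1 = 0)).resolve_left hδ'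
    linear_combination star (u 0) * z2 - star (v 0) * z1

theorem comm_facts {n : Type} [Fintype n] {B : Matrix n n ℂ} {u v : n → ℂ}
    (h : Bᴴ * B - B * Bᴴ = vecMulVec v (star v) - vecMulVec u (star u)) :
    star v ⬝ᵥ v = star u ⬝ᵥ u ∧ star v ⬝ᵥ (B *ᵥ v) = star u ⬝ᵥ (B *ᵥ u) := by
  constructor
  · have := congrArg trace h
    rw [trace_sub, trace_sub, trace_mul_comm, sub_self, trace_vecMulVec, trace_vecMulVec] at this
    rw [dotProduct_comm, dotProduct_comm (star u)]
    linear_combination -this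
  · have := congrArg (fun M => trace (M * B)) h
    simp only [Matrix.sub_mul, trace_sub] at this
    have h1 : (Bᴴ * B * B).trace = (B * Bᴴ * B).trace := by
      rw [trace_mul_comm, ← Matrix.mul_assoc]
    rw [h1, sub_self, vecMulVec_mul, vecMulVec_mul, trace_vecMulVec, trace_vecMulVec,
      dotProduct_comm, dotProduct_comm u, ← dotProduct_mulVec, ← dotProduct_mulVec] at this
    linear_combination -this

theorem exists_unit_ratio (x y : ℂ) (h : x * star x = y * star y) :
    ∃ e : ℂ, e * star e = 1 ∧ x = e * y := by
  by_cases hy : y = 0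
  · refine ⟨1, by simp, ?_⟩
    subst hy
    have : x * star x = 0 := by rw [h]; simp
    rcases mul_eq_zero.mp this with h | h
    · simp [h]
    · simp [star_eq_zero.mp h]
  · refine ⟨x / y, ?_, by field_simp⟩
    have : star y ≠ 0 := star_ne_zero.mpr hy
    rw [star_div₀]; field_simp; exact h

theorem phase3 {B : Matrix (Fin 3) (Fin 3) ℂ} {u v : Fin 3 → ℂ}
    (h : Bᴴ * B - B * Bᴴ = vecMulVec v (star v) - vecMulVec u (star u))
    (hu : u 0 = 0) (hv : v 0 = 0) (hδ : u 1 * v 2 - u 2 * v 1 ≠ 0) :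
    ∃ e c : ℂ, e * star e = 1 ∧ B *ᵥ u - Bᴴ *ᵥ (e • v) = c • u - star c • (e • v) := by
  obtain ⟨h1, h2⟩ := comm_facts h
  let b : Matrix (Fin 2) (Fin 2) ℂ := Matrix.of fun i j => B i.succ j.succ
  let p : Fin 2 → ℂ := fun i => B i.succ 0
  let q : Fin 2 → ℂ := fun j => star (B 0 j.succ)
  let u' : Fin 2 → ℂ := fun i => u i.succ
  let v' : Fin 2 → ℂ := fun i => v i.succ
  have hn : star v' ⬝ᵥ v' = star u' ⬝ᵥ u' := by
    simpa [dotProduct, Fin.sum_univ_succ, hu, hv, u', v'] using h1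
  have hb : star v' ⬝ᵥ (b *ᵥ v') = star u' ⬝ᵥ (b *ᵥ u') := by
    simpa [dotProduct, Fin.sum_univ_succ, hu, hv, u', v', b, mulVec] using h2
  obtain ⟨c, hc⟩ := two_solve b u' v' hδ hn hb
  have ent : ∀ i j, (Bᴴ * B - B * Bᴴ) i j = (vecMulVec v (star v) - vecMulVec u (star u)) i j := by
    intro i j; rw [h]
  have hmod := modulus (b := b) (p := p) (q := q) (u := u') (v := v') (β := B 0 0) (c := c)
    (by
      ext i j
      have := ent i.succ j.succ
      simp only [Matrix.sub_apply, Matrix.mul_apply, Fin.sum_univ_succ (n := 2), conjTranspose_apply,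
        vecMulVec_apply, Pi.star_apply] at this
      simp only [Matrix.sub_apply, Matrix.add_apply, Matrix.mul_apply, conjTranspose_apply,
        vecMulVec_apply, Pi.star_apply, b, p, q, u', v', Matrix.of_apply, star_star]
      linear_combination this)
    (by
      ext i
      have := ent i.succ 0
      simp only [Matrix.sub_apply, Matrix.mul_apply, Fin.sum_univ_succ (n := 2), conjTranspose_apply,
        vecMulVec_apply, Pi.star_apply, hu, hv, star_zero, mul_zero, sub_zero] at this
      simp only [Pi.sub_apply, mulVec, dotProduct, Pi.smul_apply, smul_eq_mul, conjTranspose_apply,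
        Pi.star_apply, b, p, q, Matrix.of_apply]
      linear_combination this)
    (by
      have := ent 0 0
      simp only [Matrix.sub_apply, Matrix.mul_apply, Fin.sum_univ_succ (n := 2), conjTranspose_apply,
        vecMulVec_apply, Pi.star_apply, hu, hv, star_zero, mul_zero, sub_zero] at this
      have e2 : star p ⬝ᵥ p = ∑ i : Fin 2, star (B i.succ 0) * B i.succ 0 := rfl
      have e3 : star q ⬝ᵥ q = ∑ i : Fin 2, B 0 i.succ * star (B 0 i.succ) := by
        simp [dotProduct, q]
      rw [e2, e3]
      linear_combination this)
    (by
      rw [← neg_inj, neg_sub, neg_sub]; exact hc) hn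
  obtain ⟨e, he, hx⟩ := exists_unit_ratio _ _ hmod
  have he' : star e * e = 1 := by rw [mul_comm]; exact he
  obtain ⟨c', hc'⟩ := two_solve b u' (e • v') (by
      have : u' 0 * (e • v') 1 - u' 1 * (e • v') 0 = e * (u 1 * v 2 - u 2 * v 1) := by
        simp [u', v']; ring
      rw [this]
      refine mul_ne_zero ?_ hδ
      rintro rfl; simp at he)
    (by
      rw [star_smul, smul_dotProduct, dotProduct_smul, smul_smul, he', one_smul]; exact hn)
    (by
      rw [star_smul, smul_dotProduct, mulVec_smul, dotProduct_smul, smul_smul, he', one_smul]; exact hb)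
  refine ⟨e, c', he, ?_⟩
  funext i
  refine Fin.cases ?_ ?_ i
  · have e1 : star q ⬝ᵥ u' = (B *ᵥ u) 0 := by
      simp [dotProduct, q, u', mulVec, Fin.sum_univ_succ, hu]
    have e2 : star p ⬝ᵥ v' = (Bᴴ *ᵥ v) 0 := by
      simp [dotProduct, p, v', mulVec, Fin.sum_univ_succ, hv]
    rw [e1, e2] at hx
    rw [mulVec_smul]
    simp only [Pi.sub_apply, Pi.smul_apply, smul_eq_mul, hu, hv, mul_zero, sub_zero]
    rw [hx, sub_self]
  · intro j
    have := congrFun hc' j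
    rw [mulVec_smul] at this ⊢
    have e1 : (B *ᵥ u) j.succ = (b *ᵥ u') j := by
      simp [dotProduct, b, u', mulVec, Fin.sum_univ_succ, hu]
    have e2 : (Bᴴ *ᵥ v) j.succ = (bᴴ *ᵥ v') j := by
      simp [dotProduct, b, v', mulVec, Fin.sum_univ_succ, hv]
    simp only [Pi.sub_apply, Pi.smul_apply, smul_eq_mul, e1, e2] at this ⊢
    exact this

theorem phase3' {B : Matrix (Fin 3) (Fin 3) ℂ} {u v : Fin 3 → ℂ}
    (h : Bᴴ * B - B * Bᴴ = vecMulVec v (star v) - vecMulVec u (star u))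
    (hi : ∀ s t : ℂ, s • u + t • v = 0 → s = 0 ∧ t = 0) :
    ∃ e c : ℂ, e * star e = 1 ∧ B *ᵥ u - Bᴴ *ᵥ (e • v) = c • u - star c • (e • v) := by
  let w : Fin 3 → ℂ := star ![u 1 * v 2 - u 2 * v 1, u 2 * v 0 - u 0 * v 2, u 0 * v 1 - u 1 * v 0]
  have hw : w ≠ 0 := by
    intro h0
    have h0' := congrArg star h0
    simp only [w, star_star, star_zero] at h0'
    have a0 := congrFun h0' 0
    have a1 := congrFun h0' 1
    have a2 := congrFun h0' 2
    simp at a0 a1 a2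
    have b0 := (hi (v 0) (-u 0) (by
      funext i; fin_cases i <;> simp
      · ring
      · linear_combination -a2
      · linear_combination a1)).2
    have b1 := (hi (v 1) (-u 1) (by
      funext i; fin_cases i <;> simp
      · linear_combination a2
      · ring
      · linear_combination -a0)).2
    have b2 := (hi (v 2) (-u 2) (by
      funext i; fin_cases i <;> simp
      · linear_combination -a1
      · linear_combination a0
      · ring)).2
    have : u = 0 := by
      funext i; fin_cases i
      · simpa using b0
      · simpa using b1
      · simpa using b2
    have := (hi 1 0 (by simp [this])).1
    exact one_ne_zero this
  obtain ⟨U, hU, hU', c, hc, hcU⟩ := exists_unitary w hw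
  have z0 : ∀ x : Fin 3 → ℂ, star w ⬝ᵥ x = 0 → (Uᴴ *ᵥ x) 0 = 0 := by
    intro x hx
    simp only [mulVec, dotProduct, conjTranspose_apply, hcU, star_mul']
    simp only [dotProduct, Pi.star_apply] at hx
    have : ∑ i, star c * star (w i) * x i = star c * ∑ i, star (w i) * x i := by
      rw [Finset.mul_sum]; simp only [mul_assoc]
    rw [this, hx, mul_zero]
  have hu0 := z0 u (by simp [w, dotProduct, Fin.sum_univ_three]; ring)
  have hv0 := z0 v (by simp [w, dotProduct, Fin.sum_univ_three]; ring)
  have hUi : ∀ x, U *ᵥ (Uᴴ *ᵥ x) = x := by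
    intro x; rw [mulVec_mulVec, hU, one_mulVec]
  have hi' : ∀ s t : ℂ, s • (Uᴴ *ᵥ u) + t • (Uᴴ *ᵥ v) = 0 → s = 0 ∧ t = 0 := by
    intro s t hst
    apply hi
    have := congrArg (U *ᵥ ·) hst
    simpa [mulVec_add, mulVec_smul, hUi] using this
  obtain ⟨e, c, he, hec⟩ := phase3 (B := Uᴴ * B * U) (u := Uᴴ *ᵥ u) (v := Uᴴ *ᵥ v) (by
      have e1 : (Uᴴ * B * U)ᴴ = Uᴴ * Bᴴ * U := by simp [Matrix.mul_assoc]
      have e2 : ∀ X Y : Matrix (Fin 3) (Fin 3) ℂ, (Uᴴ * X * U) * (Uᴴ * Y * U) = Uᴴ * (X * Y) * U := by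
        intro X Y
        calc (Uᴴ * X * U) * (Uᴴ * Y * U) = Uᴴ * X * (U * Uᴴ) * Y * U := by
              simp only [Matrix.mul_assoc]
          _ = _ := by rw [hU]; simp only [Matrix.mul_assoc, Matrix.one_mul]
      rw [e1, e2, e2, ← Matrix.sub_mul, ← Matrix.mul_sub, h, Matrix.mul_sub, Matrix.sub_mul,
        mul_vecMulVec, vecMulVec_mul, mul_vecMulVec, vecMulVec_mul, star_mulVec, star_mulVec,
        conjTranspose_conjTranspose]) hu0 hv0 (by
      intro h0
      set u' := Uᴴ *ᵥ u
      set v' := Uᴴ *ᵥ v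
      have b1 := (hi' (v' 1) (-u' 1) (by
        funext i; fin_cases i <;> simp [hu0, hv0]
        · ring
        · linear_combination -h0)).2
      have b2 := (hi' (v' 2) (-u' 2) (by
        funext i; fin_cases i <;> simp [hu0, hv0]
        · linear_combination h0
        · ring)).2
      have : u' = 0 := by
        funext i; fin_cases i
        · simpa using hu0
        · simpa using b1
        · simpa using b2
      have := (hi' 1 0 (by simp [this])).1
      exact one_ne_zero this)
  refine ⟨e, c, he, ?_⟩
  have := congrArg (U *ᵥ ·) hec
  have e1 : (Uᴴ * B * U)ᴴ = Uᴴ * Bᴴ * U := by simp [Matrix.mul_assoc]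
  have e3 : ∀ (X : Matrix (Fin 3) (Fin 3) ℂ) x, U *ᵥ ((Uᴴ * X * U) *ᵥ (Uᴴ *ᵥ x)) = X *ᵥ x := by
    intro X x
    rw [mulVec_mulVec, mulVec_mulVec]
    congr 1
    calc U * (Uᴴ * X * U) * Uᴴ = (U * Uᴴ) * X * (U * Uᴴ) := by simp only [Matrix.mul_assoc]
      _ = X := by rw [hU]; simp
  simp only [e1, mulVec_sub, mulVec_smul, e3, hUi] at this
  rw [mulVec_smul]
  exact this

theorem normal_eig {n : Type} [Fintype n] [DecidableEq n] [Nonempty n] (N : Matrix n n ℂ)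
    (h : Nᴴ * N = N * Nᴴ) : ∃ (μ : ℂ) (y : n → ℂ), y ≠ 0 ∧ N *ᵥ y = μ • y ∧ Nᴴ *ᵥ y = star μ • y := by
  obtain ⟨μ, hμ⟩ := Module.End.exists_eigenvalue (Matrix.toLin' N)
  obtain ⟨y, hy⟩ := hμ.exists_hasEigenvector
  have h1 : N *ᵥ y = μ • y := by
    have := hy.apply_eq_smul
    rwa [toLin'_apply] at this
  refine ⟨μ, y, hy.2, h1, ?_⟩
  set M := N - μ • (1 : Matrix n n ℂ) with hM
  have hMy : M *ᵥ y = 0 := by rw [hM, sub_mulVec, smul_mulVec, one_mulVec, h1, sub_self]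
  have hMH : Mᴴ = Nᴴ - star μ • 1 := by
    rw [hM, conjTranspose_sub, conjTranspose_smul, conjTranspose_one]
  have hMM : M * Mᴴ = Mᴴ * M := by
    rw [hMH, hM]
    simp only [Matrix.sub_mul, Matrix.mul_sub, Matrix.smul_mul, Matrix.mul_smul, Matrix.one_mul,
      Matrix.mul_one, h, smul_sub, smul_smul, mul_comm μ]
    abel
  have h2 : star (Mᴴ *ᵥ y) ⬝ᵥ (Mᴴ *ᵥ y) = 0 := by
    rw [star_mulVec, conjTranspose_conjTranspose, ← dotProduct_mulVec, mulVec_mulVec, hMM,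
      ← mulVec_mulVec, hMy, mulVec_zero, dotProduct_zero]
  have h3 : Mᴴ *ᵥ y = 0 := dotProduct_star_self_eq_zero.mp h2
  rw [hMH, sub_mulVec, smul_mulVec, one_mulVec, sub_eq_zero] at h3
  exact h3

theorem normal_ext {n : Type} [Fintype n] [DecidableEq n] (B : Matrix n n ℂ) (u v : n → ℂ) (c : ℂ)
    (hv : v ≠ 0)
    (h : Bᴴ * B - B * Bᴴ = vecMulVec v (star v) - vecMulVec u (star u))
    (huv : star v ⬝ᵥ v = star u ⬝ᵥ u)
    (hc : B *ᵥ u - Bᴴ *ᵥ v = c • u - star c • v) :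
    ∃ (μ η : ℂ) (y : n → ℂ), y ≠ 0 ∧ μ • y - B *ᵥ y = η • v ∧ star μ • y - Bᴴ *ᵥ y = η • u := by
  let M : Matrix (n ⊕ Unit) (n ⊕ Unit) ℂ :=
    fromBlocks B (replicateCol Unit v) (replicateRow Unit (star u)) (of fun _ _ => c)
  have hMH : Mᴴ = fromBlocks Bᴴ (replicateCol Unit u) (replicateRow Unit (star v)) (of fun _ _ => star c) := by
    simp only [M, fromBlocks_conjTranspose, conjTranspose_replicateCol, conjTranspose_replicateRow,
      star_star]
    congr 1
  have mv : ∀ (B : Matrix n n ℂ) (u v : n → ℂ) (c : ℂ) (z : n ⊕ Unit → ℂ),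
      fromBlocks B (replicateCol Unit v) (replicateRow Unit (star u)) (of fun _ _ => c) *ᵥ z =
      Sum.elim (B *ᵥ (z ∘ Sum.inl) + z (Sum.inr ()) • v) 
        (fun _ => star u ⬝ᵥ (z ∘ Sum.inl) + c * z (Sum.inr ())) := by
    intro B u v c z
    ext (i | i)
    · simp [mulVec, dotProduct, mul_comm]
    · simp [mulVec, dotProduct]
  have hN : Mᴴ * M = M * Mᴴ := by
    have e : ∀ i j, (Bᴴ * B) i j + u i * star (u j) = (B * Bᴴ) i j + v i * star (v j) := by
      intro i j
      have := congrFun (congrFun h i) j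
      simp only [Matrix.sub_apply, vecMulVec_apply, Pi.star_apply] at this
      linear_combination this
    have f : ∀ i, (B *ᵥ u) i - (Bᴴ *ᵥ v) i = c * u i - star c * v i := by
      intro i; simpa using congrFun hc i
    have f' : ∀ i, (star u ᵥ* Bᴴ) i - (star v ᵥ* B) i = star c * star (u i) - c * star (v i) := by
      intro i
      have := congrArg star (f i)
      rw [← conjTranspose_conjTranspose B, ← star_mulVec, ← star_mulVec, conjTranspose_conjTranspose]
      simpa using this
    rw [hMH]
    simp only [M, fromBlocks_multiply]
    congr 1
    · ext i j
      have := e i j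
      simpa [Matrix.mul_apply] using this
    · ext i j
      have := f i
      simp only [Matrix.add_apply, Matrix.mul_apply, replicateCol_apply, Matrix.of_apply,
        Finset.univ_unique, Finset.sum_singleton]
      simp only [mulVec, dotProduct] at this
      linear_combination -this
    · ext i j
      have := f' j
      simp only [Matrix.add_apply, Matrix.mul_apply, replicateRow_apply, Matrix.of_apply,
        Finset.univ_unique, Finset.sum_singleton, Pi.star_apply]
      simp only [vecMul, dotProduct, Pi.star_apply] at this
      linear_combination -this
    · ext i j
      simp only [Matrix.add_apply, Matrix.mul_apply, replicateRow_apply, replicateCol_apply,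
        Matrix.of_apply, Finset.univ_unique, Finset.sum_singleton, Pi.star_apply]
      simp only [dotProduct, Pi.star_apply] at huv
      linear_combination huv
  obtain ⟨μ, z, hz, h1, h2⟩ := normal_eig M hN
  rw [hMH, mv] at h2
  simp only [M] at h1
  rw [mv] at h1
  have a1 : ∀ i, (B *ᵥ (z ∘ Sum.inl)) i + z (Sum.inr ()) * v i = μ * z (Sum.inl i) := by
    intro i; simpa using congrFun h1 (Sum.inl i)
  have a2 : ∀ i, (Bᴴ *ᵥ (z ∘ Sum.inl)) i + z (Sum.inr ()) * u i = star μ * z (Sum.inl i) := by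
    intro i; simpa using congrFun h2 (Sum.inl i)
  refine ⟨μ, z (Sum.inr ()), z ∘ Sum.inl, ?_, ?_, ?_⟩
  · intro h0
    apply hz
    obtain ⟨i, hi⟩ := Function.ne_iff.mp hv
    have := a1 i
    have h0' : ∀ i, z (Sum.inl i) = 0 := fun i => congrFun h0 i
    rw [h0, mulVec_zero, h0'] at this
    simp at this
    have hη := this.resolve_right hi
    ext (i | i)
    · exact h0' i
    · exact hη
  · funext i
    simp only [Pi.sub_apply, Pi.smul_apply, smul_eq_mul, Function.comp]
    linear_combination -(a1 i)
  · funext i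
    simp only [Pi.sub_apply, Pi.smul_apply, smul_eq_mul, Function.comp]
    linear_combination -(a2 i)

theorem pv_of {n : Type} [Fintype n] [DecidableEq n] {B C : Matrix n n ℂ} (β : ℂ) (y x x' : n → ℂ)
    (hy : y ≠ 0) (h1 : β • y - Bᴴ *ᵥ y = (C - Bᴴ * B) *ᵥ x)
    (h2 : star β • y - B *ᵥ y = (C - B * Bᴴ) *ᵥ x') : HasPV 1 B C := by
  refine ⟨1, β, y, ?_, ⟨Sum.elim (y - B *ᵥ x) x, ?_⟩, ⟨Sum.elim (y - Bᴴ *ᵥ x') x', ?_⟩⟩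
  · intro h0; apply hy; funext i; simpa using congrFun h0 (Sum.inl i)
  · rw [fromBlocks_mulVec]
    rw [sub_mulVec, ← mulVec_mulVec, sub_eq_iff_eq_add] at h1
    simp only [Sum.elim_comp_inl, Sum.elim_comp_inr, one_mulVec, mulVec_sub, h1, one_smul]
    congr 1 <;> abel
  · rw [fromBlocks_mulVec]
    rw [sub_mulVec, ← mulVec_mulVec, sub_eq_iff_eq_add] at h2
    simp only [Sum.elim_comp_inl, Sum.elim_comp_inr, one_mulVec, mulVec_sub, h2, one_smul, star_one]
    congr 1 <;> abel

theorem pv_inf {n : Type} [Fintype n] [DecidableEq n] {B C : Matrix n n ℂ} (x x' : n → ℂ)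
    (hne : (C - Bᴴ * B) *ᵥ x ≠ 0)
    (h : (C - Bᴴ * B) *ᵥ x = (C - B * Bᴴ) *ᵥ x') : HasPV 1 B C := by
  refine ⟨0, 1, (C - Bᴴ * B) *ᵥ x, ?_, ⟨Sum.elim (- B *ᵥ x) x, ?_⟩, ⟨Sum.elim (- Bᴴ *ᵥ x') x', ?_⟩⟩
  · intro h0; apply hne; funext i; simpa using congrFun h0 (Sum.inr i)
  · rw [fromBlocks_mulVec, sub_mulVec, ← mulVec_mulVec]
    simp [neg_mulVec, mulVec_neg]
    abel_nf
  · rw [h, fromBlocks_mulVec, sub_mulVec, ← mulVec_mulVec]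
    simp [neg_mulVec, mulVec_neg]
    abel_nf

theorem HasPV.symm {n : Type} [Fintype n] {A B C : Matrix n n ℂ} (h : HasPV A Bᴴ C) : HasPV A B C := by
  obtain ⟨α, β, y, hne, h1, h2⟩ := h
  rw [conjTranspose_conjTranspose] at h1 h2
  refine ⟨star α, star β, y, ?_, h2, ?_⟩
  · intro h0
    apply hne
    ext (i | i)
    · have := congrFun h0 (Sum.inl i); simpa using this
    · have := congrFun h0 (Sum.inr i); simpa using this
  · rw [star_star, star_star]; exact h1

theorem rank_zero_eq {n : Type} [Fintype n] [DecidableEq n] {D : Matrix n n ℂ} (h : D.rank = 0) :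
    D = 0 := by
  have h1 : LinearMap.range D.mulVecLin = ⊥ := Submodule.finrank_eq_zero.mp h
  apply Matrix.ext_of_mulVec_single
  intro i
  have : D *ᵥ Pi.single i 1 ∈ LinearMap.range D.mulVecLin := ⟨_, rfl⟩
  rw [h1, Submodule.mem_bot] at this
  rw [this, zero_mulVec]

theorem rank_one_psd {n : Type} [Fintype n] [DecidableEq n] {D : Matrix n n ℂ} (hD : D.PosSemidef)
    (hr : D.rank = 1) : ∃ u : n → ℂ, u ≠ 0 ∧ D = vecMulVec u (star u) := by
  have : ∃ x, D *ᵥ x ≠ 0 := by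
    by_contra! h
    have : D = 0 := by
      apply Matrix.ext_of_mulVec_single
      intro i; rw [h, zero_mulVec]
    rw [this, rank_zero] at hr; omega
  obtain ⟨x, hx⟩ := this
  obtain ⟨s, hs, -, -, h1, -⟩ := psd_sub hD x hx
  rw [hr] at h1
  have h2 : D - (s : ℂ) • vecMulVec (D *ᵥ x) (star (D *ᵥ x)) = 0 := by
    exact rank_zero_eq (by omega)
  have hsq : (Real.sqrt s : ℂ) * (Real.sqrt s : ℂ) = s := by
    rw [← Complex.ofReal_mul, Real.mul_self_sqrt hs.le]
  refine ⟨(Real.sqrt s : ℂ) • (D *ᵥ x), ?_, ?_⟩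
  · apply smul_ne_zero _ hx
    intro h0; rw [h0] at hsq; simp at hsq; exact hs.ne (by exact_mod_cast hsq)
  · rw [star_smul, smul_vecMulVec, vecMulVec_smul, smul_smul]
    rw [sub_eq_zero] at h2
    simp only [Complex.star_def, Complex.conj_ofReal, hsq]
    exact h2

theorem split12 (B D D' : Matrix (Fin 3) (Fin 3) ℂ) (hD : D.rank = 1) (hD' : D'.rank = 2)
    (disj : Disjoint (LinearMap.range D.mulVecLin) (LinearMap.range D'.mulVecLin)) :
    ∃ (β : ℂ) (y x x' : Fin 3 → ℂ), y ≠ 0 ∧ β • y - Bᴴ *ᵥ y = D *ᵥ x ∧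
      star β • y - B *ᵥ y = D' *ᵥ x' := by
  have b1 := Module.finBasisOfFinrankEq ℂ (LinearMap.range D.mulVecLin) (n := 1) hD
  have b2 := Module.finBasisOfFinrankEq ℂ (LinearMap.range D'.mulVecLin) (n := 2) hD'
  have l1 : LinearIndependent ℂ (fun i => (b1 i : Fin 3 → ℂ)) :=
    b1.linearIndependent.map' (Submodule.subtype _) (Submodule.ker_subtype _)
  have l2 : LinearIndependent ℂ (fun i => (b2 i : Fin 3 → ℂ)) :=
    b2.linearIndependent.map' (Submodule.subtype _) (Submodule.ker_subtype _)
  have s1 : Submodule.span ℂ (Set.range (fun i => (b1 i : Fin 3 → ℂ))) ≤ LinearMap.range D.mulVecLin := by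
    rw [Submodule.span_le]; rintro _ ⟨i, rfl⟩; exact (b1 i).2
  have s2 : Submodule.span ℂ (Set.range (fun i => (b2 i : Fin 3 → ℂ))) ≤ LinearMap.range D'.mulVecLin := by
    rw [Submodule.span_le]; rintro _ ⟨i, rfl⟩; exact (b2 i).2
  have l3 := l2.sum_type l1 ((disj.mono s1 s2).symm)
  let f : Fin 3 → Fin 3 → ℂ := ![b2 0, b2 1, b1 0]
  have hf : LinearIndependent ℂ f := by
    have : f = (Sum.elim (fun i => (b2 i : Fin 3 → ℂ)) (fun i => (b1 i : Fin 3 → ℂ))) ∘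
        (finSumFinEquiv (m := 2) (n := 1)).symm := by
      funext i
      fin_cases i <;> rfl
    rw [this]
    exact l3.comp _ (Equiv.injective _)
  let T : Matrix (Fin 3) (Fin 3) ℂ := of fun i j => f j i
  have hT : IsUnit T := by
    rw [← Matrix.linearIndependent_cols_iff_isUnit]
    exact hf
  have hTd : IsUnit T.det := (Matrix.isUnit_iff_isUnit_det T).mp hT
  have hTT : T * T⁻¹ = 1 := mul_nonsing_inv _ hTd
  have hTT' : T⁻¹ * T = 1 := nonsing_inv_mul _ hTd
  have hTv : ∀ z : Fin 3 → ℂ, T *ᵥ z = z 0 • (b2 0 : Fin 3 → ℂ) + z 1 • (b2 1 : Fin 3 → ℂ) +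
      z 2 • (b1 0 : Fin 3 → ℂ) := by
    intro z; funext i
    simp [mulVec, dotProduct, Fin.sum_univ_three, T, f, mul_comm]
  let K : Matrix (Fin 3) (Fin 3) ℂ := of ![(T⁻¹ * Bᴴ * T) 0, (T⁻¹ * Bᴴ * T) 1, (T⁻¹ * B * T) 2]
  obtain ⟨β, hβ⟩ := exists_det_zero K
  obtain ⟨z, hz, hz0⟩ := Matrix.exists_mulVec_eq_zero_iff.mpr hβ
  have q : ∀ i, ![β, β, star β] i * z i - (K *ᵥ z) i = 0 := by
    intro i
    have := congrFun hz0 i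
    rw [sub_mulVec, Pi.sub_apply, mulVec_diagonal] at this
    exact this
  have q0 : β * z 0 - ((T⁻¹ * Bᴴ * T) *ᵥ z) 0 = 0 := q 0
  have q1 : β * z 1 - ((T⁻¹ * Bᴴ * T) *ᵥ z) 1 = 0 := q 1
  have q2 : star β * z 2 - ((T⁻¹ * B * T) *ᵥ z) 2 = 0 := q 2
  have e : ∀ (X : Matrix (Fin 3) (Fin 3) ℂ) (γ : ℂ), γ • (T *ᵥ z) - X *ᵥ (T *ᵥ z) =
      T *ᵥ (γ • z - (T⁻¹ * X * T) *ᵥ z) := by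
    intro X γ
    rw [mulVec_sub, mulVec_smul, mulVec_mulVec, mulVec_mulVec, Matrix.mul_assoc, ← Matrix.mul_assoc T,
      hTT, Matrix.one_mul]
  have r1 : β • (T *ᵥ z) - Bᴴ *ᵥ (T *ᵥ z) ∈ LinearMap.range D.mulVecLin := by
    rw [e, hTv]
    simp only [Pi.sub_apply, Pi.smul_apply, smul_eq_mul, q0, q1, zero_smul, zero_add]
    exact Submodule.smul_mem _ _ (b1 0).2
  have r2 : star β • (T *ᵥ z) - B *ᵥ (T *ᵥ z) ∈ LinearMap.range D'.mulVecLin := by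
    rw [e, hTv]
    simp only [Pi.sub_apply, Pi.smul_apply, smul_eq_mul, q2, zero_smul, add_zero]
    exact Submodule.add_mem _ (Submodule.smul_mem _ _ (b2 0).2) (Submodule.smul_mem _ _ (b2 1).2)
  obtain ⟨x, hx⟩ := r1
  obtain ⟨x', hx'⟩ := r2
  refine ⟨β, T *ᵥ z, x, x', ?_, hx.symm, hx'.symm⟩
  intro h0
  apply hz
  have := congrArg (T⁻¹ *ᵥ ·) h0
  simpa [mulVec_mulVec, hTT'] using this

theorem core {d : ℕ} (hd0 : 0 < d) (hd : d ≤ 3) (B C : Matrix (Fin d) (Fin d) ℂ)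
    (h1 : (C - Bᴴ * B).PosSemidef) (h2 : (C - B * Bᴴ).PosSemidef) : HasPV 1 B C := by
  have : Nonempty (Fin d) := ⟨⟨0, hd0⟩⟩
  by_cases disj : Disjoint (LinearMap.range (C - Bᴴ * B).mulVecLin)
      (LinearMap.range (C - B * Bᴴ).mulVecLin)
  swap
  · rw [Submodule.disjoint_def] at disj
    push Not at disj
    obtain ⟨w, ⟨x, hx⟩, ⟨x', hx'⟩, hw⟩ := disj
    rw [mulVecLin_apply] at hx hx'
    exact pv_inf x x' (by rw [hx]; exact hw) (by rw [hx, hx'])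
  have hle : (C - Bᴴ * B).rank + (C - B * Bᴴ).rank ≤ d := by
    have := Submodule.finrank_add_finrank_le_of_disjoint disj
    simpa [Matrix.rank] using this
  have htr : (C - Bᴴ * B).trace = (C - B * Bᴴ).trace := by
    rw [trace_sub, trace_sub, trace_mul_comm]
  have hz : (C - Bᴴ * B) = 0 ∨ (C - B * Bᴴ) = 0 → HasPV 1 B C := by
    intro h
    have hb : (C - Bᴴ * B) = 0 ∧ (C - B * Bᴴ) = 0 := by
      rcases h with h | h
      · refine ⟨h, ?_⟩
        rw [h, trace_zero] at htr
        exact h2.trace_eq_zero_iff.mp htr.symm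
      · refine ⟨?_, h⟩
        rw [h, trace_zero] at htr
        exact h1.trace_eq_zero_iff.mp htr
    have hN : Bᴴ * B = B * Bᴴ := by
      rw [← sub_eq_zero.mp hb.1, ← sub_eq_zero.mp hb.2]
    obtain ⟨μ, y, hy, e1, e2⟩ := normal_eig B hN
    refine pv_of (star μ) y 0 0 hy ?_ ?_
    · rw [e2, sub_self, mulVec_zero]
    · rw [star_star, e1, sub_self, mulVec_zero]
  by_cases z1 : (C - Bᴴ * B).rank = 0
  · exact hz (Or.inl (rank_zero_eq z1))
  by_cases z2 : (C - B * Bᴴ).rank = 0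
  · exact hz (Or.inr (rank_zero_eq z2))
  by_cases o1 : (C - Bᴴ * B).rank = 1
  · by_cases o2 : (C - B * Bᴴ).rank = 1
    · obtain ⟨u, hu, hu'⟩ := rank_one_psd h1 o1
      obtain ⟨v, hv, hv'⟩ := rank_one_psd h2 o2
      have hcomm : Bᴴ * B - B * Bᴴ = vecMulVec v (star v) - vecMulVec u (star u) := by
        rw [← hu', ← hv']; abel
      have huu : star u ⬝ᵥ u ≠ 0 := fun h => hu (dotProduct_star_self_eq_zero.mp h)
      have hvv : star v ⬝ᵥ v ≠ 0 := fun h => hv (dotProduct_star_self_eq_zero.mp h)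
      have ru : ∀ η : ℂ, vecMulVec u (star u) *ᵥ ((η / (star u ⬝ᵥ u)) • u) = η • u := by
        intro η
        rw [vecMulVec_mulVec, dotProduct_smul, smul_eq_mul, div_mul_cancel₀ _ huu]
        funext i; simp [mul_comm]
      have rv : ∀ η : ℂ, vecMulVec v (star v) *ᵥ ((η / (star v ⬝ᵥ v)) • v) = η • v := by
        intro η
        rw [vecMulVec_mulVec, dotProduct_smul, smul_eq_mul, div_mul_cancel₀ _ hvv]
        funext i; simp [mul_comm]
      have hi : ∀ s t : ℂ, s • u + t • v = 0 → s = 0 ∧ t = 0 := by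
        intro s t hst
        have hs : s • u = 0 := by
          refine Submodule.disjoint_def.mp disj _ ?_ ?_
          · rw [hu']; exact ⟨_, ru s⟩
          · rw [hv']
            refine ⟨_, (rv (-t)).trans ?_⟩
            rw [neg_smul]; exact (eq_neg_of_add_eq_zero_left hst).symm
        refine ⟨(smul_eq_zero.mp hs).resolve_right hu, ?_⟩
        rw [hs, zero_add] at hst
        exact (smul_eq_zero.mp hst).resolve_right hv
      have hphase : ∃ e c : ℂ, e * star e = 1 ∧
          B *ᵥ u - Bᴴ *ᵥ (e • v) = c • u - star c • (e • v) := by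
        obtain ⟨f1, f2⟩ := comm_facts hcomm
        have hd' : d = 2 ∨ d = 3 := by omega
        rcases hd' with rfl | rfl
        · obtain ⟨c, hc⟩ := two_solve B u v (by
            intro h0
            have b0 := (hi (v 0) (-u 0) (by
              funext i; fin_cases i <;> simp
              · ring
              · linear_combination -h0)).2
            have b1 := (hi (v 1) (-u 1) (by
              funext i; fin_cases i <;> simp
              · linear_combination h0
              · ring)).2
            apply hu
            funext i; fin_cases i
            · simpa using b0
            · simpa using b1) f1 f2
          exact ⟨1, c, by simp, by simpa using hc⟩
        · exact phase3' hcomm hi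
      obtain ⟨e, c, he, hc⟩ := hphase
      have he0 : e ≠ 0 := by rintro rfl; simp at he
      have hevv : vecMulVec (e • v) (star (e • v)) = vecMulVec v (star v) := by
        rw [star_smul, smul_vecMulVec, vecMulVec_smul, smul_smul, he, one_smul]
      obtain ⟨μ, η, y, hy, y1, y2⟩ := normal_ext B u (e • v) c (smul_ne_zero he0 hv)
        (by rw [hevv]; exact hcomm)
        (comm_facts (B := B) (by rw [hevv]; exact hcomm)).1 hc
      refine pv_of (star μ) y _ _ hy (?_ : _ = _ *ᵥ ((η / (star u ⬝ᵥ u)) • u))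
        (?_ : _ = _ *ᵥ (((η * e) / (star v ⬝ᵥ v)) • v))
      · rw [hu', ru, y2]
      · rw [hv', rv, star_star, y1, smul_smul]
    · obtain rfl : d = 3 := by omega
      obtain ⟨β, y, x, x', hy, e1, e2⟩ := split12 B _ _ o1 (by omega) disj
      exact pv_of β y x x' hy e1 e2
  · obtain rfl : d = 3 := by omega
    obtain ⟨β, y, x, x', hy, e1, e2⟩ := split12 Bᴴ _ _ (by omega : (C - B * Bᴴ).rank = 1)
      (by omega : (C - Bᴴ * B).rank = 2) disj.symm
    rw [conjTranspose_conjTranspose] at e1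
    exact pv_of (star β) y x' x hy e2 (by rw [star_star]; exact e1)

theorem core' {d : ℕ} (hd0 : 0 < d) (hd : d ≤ 3) (B C : Matrix (Fin d) (Fin d) ℂ)
    (h : BPPT 1 B C) : HasPV 1 B C := by
  have : Invertible (1 : Matrix (Fin d) (Fin d) ℂ) := invertibleOne
  apply core hd0 hd
  · have := (Matrix.PosDef.fromBlocks₁₁ B C (PosDef.one)).mp h.1
    simpa using this
  · have h2 := h.2
    have := (Matrix.PosDef.fromBlocks₁₁ Bᴴ C (PosDef.one)).mp (by
      rw [conjTranspose_conjTranspose]; exact h2)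
    simpa using this

open scoped MatrixOrder in
theorem psd_factor {n : Type} [Fintype n] [DecidableEq n] {A : Matrix n n ℂ} (h : A.PosSemidef) :
    ∃ R : Matrix n n ℂ, A = Rᴴ * R :=
  CStarAlgebra.nonneg_iff_eq_star_mul_self.mp h.nonneg

theorem d_thm : ∀ d : ℕ, d ≤ 3 → ∀ A B C : Matrix (Fin d) (Fin d) ℂ, BPPT A B C → BSep A B C := by
  intro d
  induction d with
  | zero =>
    intro _ A B C _
    have e : ∀ X : Matrix (Fin 0) (Fin 0) ℂ, X = 0 := fun X => Subsingleton.elim _ _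
    rw [e A, e B, e C]; exact BSep.zero
  | succ d ih =>
    intro hd
    have IH := ih (by omega)
    have main : ∀ N : ℕ, ∀ A B C : Matrix (Fin (d+1)) (Fin (d+1)) ℂ, BPPT A B C →
        (fromBlocks A B Bᴴ C).rank + (fromBlocks A Bᴴ B C).rank ≤ N → BSep A B C := by
      intro N
      induction N using Nat.strong_induction_on with
      | _ N ihN =>
      intro A B C h hN
      by_cases hs : ∃ y, y ≠ 0 ∧ A *ᵥ y = 0
      · obtain ⟨y, hy, hA⟩ := hs
        exact singular_step IH A B C h y hy hA
      have hAp : A.PosSemidef := by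
        have := h.1.submatrix Sum.inl
        exact this
      have hdet : A.det ≠ 0 := fun h0 => hs (by
        obtain ⟨y, hy, hy'⟩ := Matrix.exists_mulVec_eq_zero_iff.mpr h0
        exact ⟨y, hy, hy'⟩)
      obtain ⟨R, hR⟩ := psd_factor hAp
      have hRd : IsUnit R.det := by
        rw [hR, det_mul] at hdet
        exact isUnit_iff_ne_zero.mpr (right_ne_zero_of_mul hdet)
      have hRR : R * R⁻¹ = 1 := mul_nonsing_inv _ hRd
      have hRR' : R⁻¹ * R = 1 := nonsing_inv_mul _ hRd
      have hRH : Rᴴ * (R⁻¹)ᴴ = 1 := by rw [← conjTranspose_mul, hRR', conjTranspose_one]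
      have hRH' : (R⁻¹)ᴴ * Rᴴ = 1 := by rw [← conjTranspose_mul, hRR, conjTranspose_one]
      have back : ∀ X : Matrix (Fin (d+1)) (Fin (d+1)) ℂ, Rᴴ * ((R⁻¹)ᴴ * X * R⁻¹) * Rᴴᴴ = X := by
        intro X
        rw [conjTranspose_conjTranspose]
        calc _ = (Rᴴ * (R⁻¹)ᴴ) * X * (R⁻¹ * R) := by simp only [Matrix.mul_assoc]
          _ = X := by rw [hRH, hRR', Matrix.one_mul, Matrix.mul_one]
      obtain ⟨c1, c2, c3⟩ := h.conj R⁻¹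
      have cA : (R⁻¹)ᴴ * A * R⁻¹ = 1 := by
        calc _ = ((R⁻¹)ᴴ * Rᴴ) * (R * R⁻¹) := by rw [hR]; simp only [Matrix.mul_assoc]
          _ = 1 := by rw [hRH', hRR, Matrix.one_mul]
      have hpv : HasPV ((R⁻¹)ᴴ * A * R⁻¹) ((R⁻¹)ᴴ * B * R⁻¹) ((R⁻¹)ᴴ * C * R⁻¹) := by
        rw [cA] at c1 ⊢
        exact core' (by omega) hd _ _ c1
      obtain ⟨A', B', C', g1, g2, g3⟩ := hpv.step c1
      have := (g3 (ihN _ (by omega) A' B' C' g1 le_rfl)).conj Rᴴ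
      rwa [back, back, back] at this
    intro A B C h
    exact main _ A B C h le_rfl

theorem lift_aux {m k : Type} [Fintype m] [Fintype k] [DecidableEq m] [DecidableEq k]
    {S : Matrix m m ℂ} {N : Matrix m k ℂ} {L : Matrix k k ℂ}
    (h : (fromBlocks S N Nᴴ L).PosSemidef) :
    ∃ Z : Matrix m k ℂ, N = S * Z ∧ (L - Zᴴ * S * Z).PosSemidef := by
  have hS : Sᴴ = S := by
    have := h.1
    rw [IsHermitian, fromBlocks_conjTranspose] at this
    exact (fromBlocks_inj.mp this).1
  obtain ⟨G, hG⟩ := psd_factor h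
  let G1 : Matrix (m ⊕ k) m ℂ := G.submatrix id Sum.inl
  let G2 : Matrix (m ⊕ k) k ℂ := G.submatrix id Sum.inr
  have e1 : S = G1ᴴ * G1 := by
    ext i j
    have := congrFun (congrFun hG (Sum.inl i)) (Sum.inl j)
    simpa [Matrix.mul_apply, G1] using this
  have e2 : N = G1ᴴ * G2 := by
    ext i j
    have := congrFun (congrFun hG (Sum.inl i)) (Sum.inr j)
    simpa [Matrix.mul_apply, G1, G2] using this
  have hr : LinearMap.range S.mulVecLin = LinearMap.range (G1ᴴ).mulVecLin := by
    apply Submodule.eq_of_le_of_finrank_eq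
    · rw [e1, mulVecLin_mul]; exact LinearMap.range_comp_le_range _ _
    · have h1 := rank_conjTranspose_mul_self G1
      rw [← rank_conjTranspose G1, ← e1] at h1
      exact h1
  have hz : ∀ j, ∃ z, S *ᵥ z = N.col j := by
    intro j
    have : N.col j ∈ LinearMap.range S.mulVecLin := by
      rw [hr]
      refine ⟨G2.col j, ?_⟩
      funext i
      rw [e2]
      simp [Matrix.mul_apply, mulVec, dotProduct, Matrix.col]
    exact this
  choose z hz using hz
  have hN : N = S * (of fun i j => z j i) := by
    ext i j
    have := congrFun (hz j) i
    simp only [mulVec, dotProduct, Matrix.col_apply] at this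
    rw [← this]
    simp [Matrix.mul_apply]
  refine ⟨of fun i j => z j i, hN, ?_⟩
  set Z : Matrix m k ℂ := of fun i j => z j i
  have h2 := (h.conjTranspose_mul_mul_same (fromBlocks (0 : Matrix m m ℂ) (-Z) 0 (1 : Matrix k k ℂ))).submatrix Sum.inr
  have e3 : (fromBlocks (0 : Matrix m m ℂ) (-Z) 0 (1 : Matrix k k ℂ))ᴴ * fromBlocks S N Nᴴ L *
      (fromBlocks (0 : Matrix m m ℂ) (-Z) 0 (1 : Matrix k k ℂ)) = fromBlocks 0 0 0 (L - Zᴴ * S * Z) := by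
    have hNH : Nᴴ = Zᴴ * S := by rw [hN, conjTranspose_mul, hS]
    rw [hNH, fromBlocks_conjTranspose, fromBlocks_multiply, fromBlocks_multiply, hN]
    simp [Matrix.mul_assoc, neg_add_eq_sub]
  rw [e3] at h2
  exact h2

theorem BSep.exists_sum {n : Type} {A B C : Matrix n n ℂ} (h : BSep A B C) :
    ∃ (T : ℕ) (α β : Fin T → ℂ) (y : Fin T → n → ℂ), fromBlocks A B Bᴴ C =
      ∑ t, vecMulVec (Sum.elim (α t • y t) (β t • y t) : n ⊕ n → ℂ)
        (star (Sum.elim (α t • y t) (β t • y t))) := by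
  induction h with
  | zero => exact ⟨0, fun _ => 0, fun _ => 0, fun _ => 0, by simp⟩
  | @cons A B C α β y h ih =>
    obtain ⟨T, α', β', y', hs⟩ := ih
    refine ⟨T + 1, Fin.cons α α', Fin.cons β β', Fin.cons y y', ?_⟩
    rw [Fin.sum_univ_succ]
    simp only [Fin.cons_zero, Fin.cons_succ]
    rw [← hs, outer_blocks, fromBlocks_add]
    congr 1
    · abel
    · abel
    · simp [conjTranspose_vecMulVec, mul_comm, add_comm]
    · abel

theorem SNle.add {m n k : ℕ} {ρ σ : Matrix (Fin m × Fin n) (Fin m × Fin n) ℂ} (h : SNle ρ k)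
    (h' : SNle σ k) : SNle (ρ + σ) k := by
  obtain ⟨T, v, hv, rfl⟩ := h
  obtain ⟨T', v', hv', rfl⟩ := h'
  refine ⟨T + T', Fin.append v v', ?_, ?_⟩
  · intro t
    refine Fin.addCases (fun i => ?_) (fun i => ?_) t
    · rw [Fin.append_left]; exact hv i
    · rw [Fin.append_right]; exact hv' i
  · rw [Fin.sum_univ_add]; simp

theorem outer_eq {d : Type} (v : d → ℂ) : outer v = vecMulVec v (star v) := by
  ext i j; simp [outer, vecMulVec_apply]

theorem SNle.conj {k : ℕ} {ρ : Matrix (Fin 3 × Fin 4) (Fin 3 × Fin 4) ℂ} (h : SNle ρ k)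
    (U : Matrix (Fin 3) (Fin 3) ℂ) :
    SNle ((U ⊗ₖ (1 : Matrix (Fin 4) (Fin 4) ℂ)) * ρ * (U ⊗ₖ (1 : Matrix (Fin 4) (Fin 4) ℂ))ᴴ) k := by
  obtain ⟨T, v, hv, rfl⟩ := h
  refine ⟨T, fun t => (U ⊗ₖ (1 : Matrix (Fin 4) (Fin 4) ℂ)) *ᵥ v t, ?_, ?_⟩
  · intro t
    refine le_trans ?_ (hv t)
    unfold schmidtRank
    have : (Matrix.of fun i j => ((U ⊗ₖ (1 : Matrix (Fin 4) (Fin 4) ℂ)) *ᵥ v t) (i, j) :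
        Matrix (Fin 3) (Fin 4) ℂ) = U * (Matrix.of fun i j => v t (i, j)) := by
      ext i j
      simp [mulVec, dotProduct, Matrix.mul_apply, Fintype.sum_prod_type, kroneckerMap_apply,
        Matrix.one_apply]
    rw [this]
    exact rank_mul_le_right _ _
  · rw [Matrix.mul_sum, Matrix.sum_mul]
    refine Finset.sum_congr rfl fun t _ => ?_
    rw [outer_eq, outer_eq, mul_vecMulVec, vecMulVec_mul, star_mulVec]

theorem mrank_add_le (M N : Matrix (Fin 3) (Fin 4) ℂ) : (M + N).rank ≤ M.rank + N.rank := by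
  unfold Matrix.rank
  rw [mulVecLin_add]
  exact (Submodule.finrank_mono (LinearMap.range_add_le _ _)).trans
    (Submodule.finrank_add_le_finrank_add_finrank _ _)

def idx : (Fin 4 ⊕ Fin 4) ⊕ Fin 4 → Fin 3 × Fin 4 :=
  Sum.elim (Sum.elim (fun j => (0, j)) (fun j => (1, j))) (fun j => (2, j))

theorem idx_surj (p : Fin 3 × Fin 4) : ∃ x, idx x = p := by
  obtain ⟨i, j⟩ := p
  fin_cases i
  · exact ⟨Sum.inl (Sum.inl j), rfl⟩
  · exact ⟨Sum.inl (Sum.inr j), rfl⟩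
  · exact ⟨Sum.inr j, rfl⟩

theorem main_coord (ρ : Matrix (Fin 3 × Fin 4) (Fin 3 × Fin 4) ℂ) (hρ : ρ.PosSemidef)
    (hppt : (ptB ρ).PosSemidef) (b : Fin 4 → ℂ) (hb : b ≠ 0)
    (hker : ∀ j, ∑ l, ρ (0, j) (0, l) * b l = 0) : SNle ρ 2 := by
  let A : Matrix (Fin 4) (Fin 4) ℂ := of fun j l => ρ (0, j) (0, l)
  let B : Matrix (Fin 4) (Fin 4) ℂ := of fun j l => ρ (0, j) (1, l)
  let C : Matrix (Fin 4) (Fin 4) ℂ := of fun j l => ρ (1, j) (1, l)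
  have hH : ∀ p q, star (ρ p q) = ρ q p := fun p q => hρ.1.apply q p
  have hppt' : BPPT A B C := by
    constructor
    · have e : fromBlocks A B Bᴴ C = ρ.submatrix (idx ∘ Sum.inl) (idx ∘ Sum.inl) := by
        ext (i | i) (j | j) <;> simp only [submatrix_apply, fromBlocks_apply₁₁,
          fromBlocks_apply₁₂, fromBlocks_apply₂₁, fromBlocks_apply₂₂, conjTranspose_apply, A, B, C,
          Matrix.of_apply, hH] <;> rfl
      rw [e]; exact hρ.submatrix _
    · have e : fromBlocks A Bᴴ B C =
          ((ptB ρ).submatrix (idx ∘ Sum.inl) (idx ∘ Sum.inl))ᵀ := by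
        ext (i | i) (j | j) <;> simp only [submatrix_apply, fromBlocks_apply₁₁,
          fromBlocks_apply₁₂, fromBlocks_apply₂₁, fromBlocks_apply₂₂, conjTranspose_apply, A, B, C,
          Matrix.of_apply, hH, transpose_apply] <;> rfl
      rw [e]; exact (hppt.submatrix _).transpose
  have hsep : BSep A B C := singular_step (d_thm 3 le_rfl) A B C hppt' b hb (by
    funext j; exact hker j)
  obtain ⟨T, α, β, y, hS⟩ := hsep.exists_sum
  let N : Matrix (Fin 4 ⊕ Fin 4) (Fin 4) ℂ := of fun x l => ρ (idx (Sum.inl x)) (2, l)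
  let L : Matrix (Fin 4) (Fin 4) ℂ := of fun j l => ρ (2, j) (2, l)
  have hblock : ρ.submatrix idx idx = fromBlocks (fromBlocks A B Bᴴ C) N Nᴴ L := by
    ext ((i | i) | i) ((j | j) | j) <;> simp only [submatrix_apply, fromBlocks_apply₁₁,
      fromBlocks_apply₁₂, fromBlocks_apply₂₁, fromBlocks_apply₂₂, conjTranspose_apply, A, B, C, N, L,
      Matrix.of_apply, hH] <;> rfl
  obtain ⟨Z, hZ, hL⟩ := lift_aux (hblock ▸ hρ.submatrix idx)
  obtain ⟨R, l, hl⟩ := Matrix.posSemidef_iff_eq_sum_vecMulVec.mp hL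
  let P : Matrix (Fin 4 ⊕ Fin 4) (Fin T) ℂ :=
    of fun i t => (Sum.elim (α t • y t) (β t • y t) : Fin 4 ⊕ Fin 4 → ℂ) i
  have hSP : fromBlocks A B Bᴴ C = P * Pᴴ := by
    rw [hS]; ext i j
    simp [Matrix.sum_apply, Matrix.mul_apply, P, vecMulVec_apply]
  rw [hSP] at hZ hl hblock
  let X : Matrix (Fin T) (Fin 4) ℂ := Pᴴ * Z
  have hN : N = P * X := by rw [hZ, Matrix.mul_assoc]
  have hLX : L = Xᴴ * X + ∑ i, vecMulVec (l i) (star (l i)) := by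
    rw [← hl]; simp [X, Matrix.mul_assoc]
  let v : Fin T → Fin 3 × Fin 4 → ℂ := fun t p => ![α t * y t p.2, β t * y t p.2, star (X t p.2)] p.1
  let w : Fin R → Fin 3 × Fin 4 → ℂ := fun r p => ![0, 0, l r p.2] p.1
  have hsum : ρ = ∑ t, outer (v t) + ∑ r, outer (w r) := by
    ext p q
    obtain ⟨p, rfl⟩ := idx_surj p
    obtain ⟨q, rfl⟩ := idx_surj q
    have h0 := congrFun (congrFun hblock p) q
    rw [submatrix_apply] at h0
    rw [h0, hN, hLX]
    clear_value X
    rw [Matrix.add_apply, Matrix.sum_apply, Matrix.sum_apply]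
    rcases p with ((i | i) | i) <;> rcases q with ((j | j) | j)
    case inr.inr =>
      rw [fromBlocks_apply₂₂, Matrix.add_apply, Matrix.sum_apply, Matrix.mul_apply]
      congr 1
      refine Finset.sum_congr rfl fun t _ => ?_
      simp [outer, idx, v]
    all_goals
      rw [Finset.sum_eq_zero (s := Finset.univ) (f := fun r => outer (w r) _ _) (fun r _ => by
        simp [outer, idx, w]), add_zero]
      simp only [fromBlocks_apply₁₁, fromBlocks_apply₁₂, fromBlocks_apply₂₁, conjTranspose_apply,
        Matrix.mul_apply, star_sum]
      refine Finset.sum_congr rfl fun t _ => ?_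
      simp [outer, idx, v, P, Matrix.mul_apply]
    all_goals try ring
  rw [hsum]
  refine SNle.add ⟨T, v, ?_, rfl⟩ ⟨R, w, ?_, rfl⟩
  · intro t
    unfold schmidtRank
    have : (Matrix.of fun i j => v t (i, j) : Matrix (Fin 3) (Fin 4) ℂ) =
        vecMulVec ![α t, β t, 0] (y t) + vecMulVec ![0, 0, 1] (star (X t)) := by
      ext i j; rw [Matrix.add_apply, vecMulVec_apply, vecMulVec_apply]; fin_cases i <;> simp [v]
    rw [this]
    refine (mrank_add_le _ _).trans ?_
    have h1 := rank_vecMulVec_le ![α t, β t, 0] (y t)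
    have h2 := rank_vecMulVec_le ![0, 0, 1] (star (X t))
    omega
  · intro r
    unfold schmidtRank
    have : (Matrix.of fun i j => w r (i, j) : Matrix (Fin 3) (Fin 4) ℂ) =
        vecMulVec ![0, 0, 1] (l r) := by
      ext i j; rw [vecMulVec_apply]; fin_cases i <;> simp [w]
    rw [this]
    exact (rank_vecMulVec_le _ _).trans (by norm_num)

theorem ptB_conj (ρ : Matrix (Fin 3 × Fin 4) (Fin 3 × Fin 4) ℂ) (U : Matrix (Fin 3) (Fin 3) ℂ) :
    ptB ((U ⊗ₖ (1 : Matrix (Fin 4) (Fin 4) ℂ))ᴴ * ρ * (U ⊗ₖ (1 : Matrix (Fin 4) (Fin 4) ℂ))) =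
    (U ⊗ₖ (1 : Matrix (Fin 4) (Fin 4) ℂ))ᴴ * ptB ρ * (U ⊗ₖ (1 : Matrix (Fin 4) (Fin 4) ℂ)) := by
  have e : ∀ (M : Matrix (Fin 3 × Fin 4) (Fin 3 × Fin 4) ℂ) (i k : Fin 3) (j l : Fin 4),
    ((U ⊗ₖ (1 : Matrix (Fin 4) (Fin 4) ℂ))ᴴ * M * (U ⊗ₖ (1 : Matrix (Fin 4) (Fin 4) ℂ))) (i, j) (k, l) =
      ∑ c, (∑ a, star (U a i) * M (a, j) (c, l)) * U c k := by
    intro M i k j l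
    rw [Matrix.mul_apply, Fintype.sum_prod_type]
    refine Finset.sum_congr rfl fun c _ => ?_
    simp only [kroneckerMap_apply, Matrix.one_apply, mul_ite, mul_one, mul_zero, Finset.sum_ite_eq',
      Finset.mem_univ, if_true]
    congr 1
    rw [Matrix.mul_apply, Fintype.sum_prod_type]
    refine Finset.sum_congr rfl fun a _ => ?_
    simp only [conjTranspose_apply, kroneckerMap_apply, Matrix.one_apply]
    rw [Finset.sum_eq_single j]
    · simp
    · intro x _ hx; simp [hx]
    · simp
  ext ⟨i, j⟩ ⟨k, l⟩
  rw [e]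
  simp only [ptB, Matrix.of_apply]
  exact e ρ i k l j

/-- Any 3×4 PPT state with a product vector in its kernel has Schmidt number at most 2. -/
theorem ppt_3x4_product_kernel_SN_le_two
    (ρ : Matrix (Fin 3 × Fin 4) (Fin 3 × Fin 4) ℂ) (hρ : ρ.PosSemidef)
    (hppt : (ptB ρ).PosSemidef)
    (a : Fin 3 → ℂ) (b : Fin 4 → ℂ) (ha : a ≠ 0) (hb : b ≠ 0)
    (hker : ρ.mulVec (fun p => a p.1 * b p.2) = 0) :
    SNle ρ 2 := by
  obtain ⟨U, hU, -, c, hc, hcU⟩ := exists_unitary a ha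
  set W : Matrix (Fin 3 × Fin 4) (Fin 3 × Fin 4) ℂ := U ⊗ₖ (1 : Matrix (Fin 4) (Fin 4) ℂ) with hW
  have hWW : W * Wᴴ = 1 := by
    rw [hW, conjTranspose_kronecker, ← mul_kronecker_mul, hU]; simp
  have h1 : SNle (Wᴴ * ρ * W) 2 := by
    refine main_coord _ (hρ.conjTranspose_mul_mul_same W) ?_ b hb ?_
    · rw [hW, ptB_conj]; exact hppt.conjTranspose_mul_mul_same _
    · intro j
      let x : Fin 3 × Fin 4 → ℂ := fun p => if p.1 = 0 then b p.2 else 0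
      have hx : W *ᵥ x = c • (fun p => a p.1 * b p.2) := by
        ext ⟨i, j⟩
        simp [mulVec, dotProduct, Fintype.sum_prod_type, hW, x, kroneckerMap_apply, Matrix.one_apply,
          hcU, mul_assoc]
      have h0 : (Wᴴ * ρ * W) *ᵥ x = 0 := by
        rw [← mulVec_mulVec, ← mulVec_mulVec, hx, mulVec_smul, hker]; simp
      have this : ((Wᴴ * ρ * W) *ᵥ x) (0, j) = 0 := by rw [h0]; rfl
      refine Eq.trans ?_ this
      simp only [mulVec, dotProduct, Fintype.sum_prod_type, x]
      symm
      rw [Finset.sum_eq_single 0]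
      · simp
      · intro i _ hi; simp [hi]
      · simp
  have h2 := h1.conj U
  rw [← hW] at h2
  have e : W * (Wᴴ * ρ * W) * Wᴴ = ρ := by
    calc _ = (W * Wᴴ) * ρ * (W * Wᴴ) := by simp only [Matrix.mul_assoc]
      _ = ρ := by rw [hWW]; simp
  rwa [e] at h2
end
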